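/- Let d ≥ 1 and let D be a linearly repetitive Delone set in ℝ^d. Then D is rectifiable: there exists a bijection f : D → ℤ^d and a constant K ≥ 1 such that (1/K)·‖u − v‖ ≤ ‖f(u) − f(v)‖ ≤ K·‖u − v‖ for all u, v ∈ D. -/

import Mathlib

/-- The integer lattice ℤ^d inside `EuclideanSpace ℝ (Fin d)`:
the set of points all of whose coordinates are integers. -/
def intLattice (d : ℕ) : Set (EuclideanSpace ℝ (Fin d)) :=
  {x | ∀ i : Fin d, ∃ n : ℤ, x i = (n : ℝ)}

open MeasureTheory Set Filter Topology
open scoped ENNReal NNReal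

theorem map_withDensity_eq_of_intervalIntegral_eq {f g : ℝ → ℝ} (hf : Continuous f)
    (hg : Continuous g) (hf0 : ∀ t, 0 ≤ f t) (hg0 : ∀ t, 0 ≤ g t) {h : ℝ → ℝ}
    (hc : Continuous h) (hm : StrictMono h) (hs : Function.Surjective h)
    (hint : ∀ a b, a ≤ b → ∫ t in h a..h b, g t = ∫ t in a..b, f t) :
    Measure.map h (volume.withDensity fun t => ENNReal.ofReal (f t)) =
      volume.withDensity fun t => ENNReal.ofReal (g t) := by
  have key : ∀ {u : ℝ → ℝ}, Continuous u → (∀ t, 0 ≤ u t) → ∀ a b, a ≤ b →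
      (volume.withDensity fun t => ENNReal.ofReal (u t)) (Ioc a b) =
        ENNReal.ofReal (∫ t in a..b, u t) := by
    intro u hu hu0 a b hab
    rw [withDensity_apply _ measurableSet_Ioc, intervalIntegral.integral_of_le hab,
      ofReal_integral_eq_lintegral_ofReal]
    · exact (hu.integrableOn_Icc (a := a) (b := b)).mono_set Ioc_subset_Icc_self
    · exact Eventually.of_forall hu0
  have : IsLocallyFiniteMeasure (volume.withDensity fun t => ENNReal.ofReal (g t)) :=
    IsLocallyFiniteMeasure.withDensity_ofReal hg
  symm
  refine Measure.ext_of_Ioc _ _ fun c d hcd => ?_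
  obtain ⟨a, rfl⟩ := hs c
  obtain ⟨b, rfl⟩ := hs d
  have hab : a ≤ b := (hm.lt_iff_lt.1 hcd).le
  have hpre : h ⁻¹' Ioc (h a) (h b) = Ioc a b := by
    ext t; simp [hm.lt_iff_lt, hm.le_iff_le]
  rw [Measure.map_apply hc.measurable measurableSet_Ioc, hpre, key hf hf0 _ _ hab,
    key hg hg0 _ _ hcd.le, hint a b hab]

theorem map_withDensity_eq_of_lines {ι : Type*} [Fintype ι] [DecidableEq ι]
    {f g : (ι → ℝ) → ℝ} (hf : Continuous f) (hg : Continuous g) (i : ι)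
    {H : (ι → ℝ) → ι → ℝ} (hH : Continuous H) (h : (ι → ℝ) → ℝ → ℝ)
    (hHh : ∀ x t, H (Function.update x i t) = Function.update x i (h x t))
    (hmap : ∀ x, Measure.map (h x)
        (volume.withDensity fun t => ENNReal.ofReal (f (Function.update x i t))) =
      volume.withDensity fun t => ENNReal.ofReal (g (Function.update x i t))) :
    Measure.map H (volume.withDensity fun x => ENNReal.ofReal (f x)) =
      volume.withDensity fun x => ENNReal.ofReal (g x) := by
  have hf' : Measurable fun x => ENNReal.ofReal (f x) := hf.measurable.ennreal_ofReal
  have hg' : Measurable fun x => ENNReal.ofReal (g x) := hg.measurable.ennreal_ofReal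
  refine Measure.ext_of_lintegral _ fun u hu => ?_
  have huH : Measurable fun x => u (H x) := hu.comp hH.measurable
  rw [lintegral_map hu hH.measurable,
    lintegral_withDensity_eq_lintegral_mul _ hf' huH,
    lintegral_withDensity_eq_lintegral_mul _ hg' hu]
  refine lintegral_eq_of_lmarginal_eq {i} (hf'.mul huH) (hg'.mul hu) ?_
  rw [lmarginal_singleton, lmarginal_singleton]
  funext x
  have hupd : Continuous fun t : ℝ => Function.update x i t := continuous_const.update i continuous_id
  have hux : Measurable fun t : ℝ => u (Function.update x i t) := hu.comp hupd.measurable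
  have hhx : h x = fun t => H (Function.update x i t) i := by
    funext t; simp [hHh]
  have hhm : Measurable (h x) := by
    rw [hhx]; exact ((continuous_apply i).comp (hH.comp hupd)).measurable
  have huh : Measurable fun t => u (Function.update x i (h x t)) := hux.comp hhm
  have hfx : Measurable fun t => ENNReal.ofReal (f (Function.update x i t)) :=
    hf'.comp hupd.measurable
  have hgx : Measurable fun t => ENNReal.ofReal (g (Function.update x i t)) :=
    hg'.comp hupd.measurable
  have := congrArg (fun m => ∫⁻ t, u (Function.update x i t) ∂m) (hmap x)
  rw [lintegral_map hux hhm,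
    lintegral_withDensity_eq_lintegral_mul _ hfx huh,
    lintegral_withDensity_eq_lintegral_mul _ hgx hux] at this
  simpa [hHh] using this

/-- `f` and `g` are densities, and a `K`-bi-Lipschitz homeomorphism pushes `f` to `g`. -/
def BilipTransport {ι : Type*} [Fintype ι] (K : ℝ≥0) (f g : (ι → ℝ) → ℝ) : Prop :=
  ∃ H : (ι → ℝ) ≃ₜ (ι → ℝ), LipschitzWith K H ∧ AntilipschitzWith K H ∧
    Measure.map H (volume.withDensity fun x => ENNReal.ofReal (f x)) =
      volume.withDensity fun x => ENNReal.ofReal (g x)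

theorem BilipTransport.refl {ι : Type*} [Fintype ι] (f : (ι → ℝ) → ℝ) : BilipTransport 1 f f :=
  ⟨Homeomorph.refl _, LipschitzWith.id, AntilipschitzWith.id, by simp⟩

theorem BilipTransport.trans {ι : Type*} [Fintype ι] {K₁ K₂ : ℝ≥0} {f g k : (ι → ℝ) → ℝ}
    (h₁ : BilipTransport K₁ f g) (h₂ : BilipTransport K₂ g k) : BilipTransport (K₂ * K₁) f k := by
  obtain ⟨H₁, hl₁, ha₁, hm₁⟩ := h₁
  obtain ⟨H₂, hl₂, ha₂, hm₂⟩ := h₂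
  refine ⟨H₁.trans H₂, hl₂.comp hl₁, ?_, ?_⟩
  · rw [mul_comm]; exact ha₂.comp ha₁
  · change Measure.map (H₂ ∘ H₁) _ = _
    rw [← Measure.map_map H₂.continuous.measurable H₁.continuous.measurable, hm₁, hm₂]

section Step
variable {ι : Type*} [Fintype ι] [DecidableEq ι]

theorem dist_single_le (i : ι) (s t : ℝ) :
    dist (Pi.single i s : ι → ℝ) (Pi.single i t) ≤ |s - t| := by
  rw [dist_pi_le_iff (abs_nonneg _)]
  intro j
  by_cases h : j = i
  · subst h; simp [Real.dist_eq]
  · simp [h]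

theorem add_single_continuous {ι : Type*} [DecidableEq ι] (x : ι → ℝ) (i : ι) :
    Continuous fun s : ℝ => x + Pi.single i s :=
  continuous_const.add (continuous_const.update i continuous_id)

theorem abs_intervalIntegral_sub_le {u v : ℝ → ℝ} (hu : Continuous u) (hv : Continuous v) {M : ℝ}
    (h : ∀ s, |u s - v s| ≤ M) (a : ℝ) :
    |(∫ s in (0 : ℝ)..a, u s) - ∫ s in (0 : ℝ)..a, v s| ≤ M * |a| := by
  rw [← intervalIntegral.integral_sub (hu.intervalIntegrable _ _) (hv.intervalIntegrable _ _)]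
  simpa using intervalIntegral.norm_integral_le_of_norm_le_const (a := (0 : ℝ)) (b := a)
    (f := fun s => u s - v s) (C := M) fun s _ => h s

/-- If `g` is at least `1/2`, then so are its mean values. -/
theorem half_abs_sub_le_abs_intervalIntegral {u : ℝ → ℝ} (hu : Continuous u)
    (h : ∀ s, 1 / 2 ≤ u s) (a b : ℝ) : |b - a| / 2 ≤ |∫ s in a..b, u s| := by
  wlog hab : a ≤ b generalizing a b
  · rw [intervalIntegral.integral_symm, abs_neg, abs_sub_comm]
    exact this b a (le_of_not_ge hab)
  have := intervalIntegral.integral_mono_on (μ := volume) hab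
    (intervalIntegrable_const (c := (1 / 2 : ℝ))) (hu.intervalIntegrable a b) fun s _ => h s
  rw [intervalIntegral.integral_const, smul_eq_mul] at this
  rw [abs_of_nonneg (sub_nonneg.2 hab)]
  exact le_trans (by linarith) (le_abs_self _)

theorem exists_intervalIntegral_eq {u : ℝ → ℝ} (hu : Continuous u)
    (h : ∀ s, 1 / 2 ≤ u s) (c : ℝ) : ∃ b, ∫ s in (0 : ℝ)..b, u s = c := by
  have hcont : Continuous fun b => ∫ s in (0 : ℝ)..b, u s :=
    intervalIntegral.continuous_primitive (fun a b => hu.intervalIntegrable a b) 0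
  have hpos : ∀ b : ℝ, 0 ≤ b → b / 2 ≤ ∫ s in (0 : ℝ)..b, u s := by
    intro b hb
    have := half_abs_sub_le_abs_intervalIntegral hu h 0 b
    rwa [sub_zero, abs_of_nonneg hb, abs_of_nonneg] at this
    exact intervalIntegral.integral_nonneg hb fun s _ => by linarith [h s]
  have hneg : ∀ b : ℝ, b ≤ 0 → ∫ s in (0 : ℝ)..b, u s ≤ b / 2 := by
    intro b hb
    have := half_abs_sub_le_abs_intervalIntegral hu h b 0
    rw [zero_sub, abs_neg, abs_of_nonpos hb, abs_of_nonneg] at this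
    · rw [intervalIntegral.integral_symm]; linarith
    exact intervalIntegral.integral_nonneg hb fun s _ => by linarith [h s]
  have h1 := hneg (-(2 * |c|)) (by simp)
  have h2 := hpos (2 * |c|) (by simp)
  have := intermediate_value_Icc (a := -(2 * |c|)) (b := 2 * |c|) (by linarith [abs_nonneg c])
    hcont.continuousOn
  obtain ⟨b, -, hb⟩ := this (show c ∈ Icc _ _ from
    ⟨by linarith [neg_abs_le c], by linarith [le_abs_self c]⟩)
  exact ⟨b, hb⟩

theorem bilipTransport_average {f : (ι → ℝ) → ℝ} (i : ι) {l : ℝ≥0} {L : ℝ} (hL : 0 < L)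
    (hf1 : ∀ x, |f x - 1| ≤ 1 / 2) (hfl : LipschitzWith l f) (hLl : L * l ≤ 1 / 4) :
    BilipTransport (1 + 4 * L.toNNReal * l) f fun x => (f x + f (x + Pi.single i L)) / 2 := by
  set g : (ι → ℝ) → ℝ := fun x => (f x + f (x + Pi.single i L)) / 2 with hgdef
  have hfc := hfl.continuous
  have hgc : Continuous g := by fun_prop
  have hfdist : ∀ x y, |f x - f y| ≤ l * dist x y := fun x y => by
    simpa [Real.dist_eq] using hfl.dist_le_mul x y
  have hfhalf : ∀ x, 1 / 2 ≤ f x := fun x => by linarith [(abs_le.1 (hf1 x)).1]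
  have hghalf : ∀ x, 1 / 2 ≤ g x := fun x => by
    simp only [hgdef]; linarith [hfhalf x, hfhalf (x + Pi.single i L)]
  have hgdist : ∀ x y, |g x - g y| ≤ l * dist x y := fun x y => by
    have h1 := hfdist x y
    have h2 := hfdist (x + Pi.single i L) (y + Pi.single i L)
    rw [dist_add_right] at h2
    rw [abs_le] at *
    simp only [hgdef]
    constructor <;> linarith
  have hline := fun x => add_single_continuous x i
  have hfx : ∀ x, Continuous fun s : ℝ => f (x + Pi.single i s) := fun x => hfc.comp (hline x)
  have hgx : ∀ x, Continuous fun s : ℝ => g (x + Pi.single i s) := fun x => hgc.comp (hline x)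
  set P : (ι → ℝ) → ℝ := fun x => (∫ s in (0 : ℝ)..L, (1 - f (x + Pi.single i s))) / 2 with hPdef
  have hPbound : ∀ x, |P x| ≤ L / 4 := fun x => by
    have := intervalIntegral.norm_integral_le_of_norm_le_const (a := (0 : ℝ)) (b := L)
      (f := fun s => 1 - f (x + Pi.single i s)) (C := 1 / 2) fun s _ => by
        rw [Real.norm_eq_abs, abs_sub_comm]; exact hf1 _
    rw [Real.norm_eq_abs, sub_zero, abs_of_pos hL] at this
    simp only [hPdef, abs_div, abs_two]
    linarith
  have hPdist : ∀ x y, |P x - P y| ≤ L * l / 2 * dist x y := fun x y => by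
    have := abs_intervalIntegral_sub_le (u := fun s => 1 - f (x + Pi.single i s))
      (v := fun s => 1 - f (y + Pi.single i s)) (continuous_const.sub (hfx x))
      (continuous_const.sub (hfx y)) (M := l * dist x y) (fun s => by
        have := hfdist (y + Pi.single i s) (x + Pi.single i s)
        rw [dist_add_right, dist_comm] at this
        convert this using 2
        ring) L
    rw [abs_of_pos hL] at this
    simp only [hPdef, ← sub_div, abs_div, abs_two]
    linarith
  have hex := fun x => exists_intervalIntegral_eq (hgx x) (fun s => hghalf _) (P x)
  choose τ hτ using hex
  have hτbound : ∀ x, |τ x| ≤ L / 2 := fun x => by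
    have h1 := half_abs_sub_le_abs_intervalIntegral (hgx x) (fun s => hghalf _) 0 (τ x)
    rw [hτ, sub_zero] at h1
    linarith [hPbound x]
  have hτdist : ∀ x y, |τ x - τ y| ≤ 2 * L * l * dist x y := fun x y => by
    have h1 := half_abs_sub_le_abs_intervalIntegral (hgx y) (fun s => hghalf _) (τ y) (τ x)
    rw [← intervalIntegral.integral_interval_sub_left
      ((hgx y).intervalIntegrable 0 _) ((hgx y).intervalIntegrable 0 _), hτ y] at h1
    have h2 := abs_intervalIntegral_sub_le (hgx y) (hgx x) (M := l * dist x y) (fun s => by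
        have := hgdist (y + Pi.single i s) (x + Pi.single i s)
        rwa [dist_add_right, dist_comm] at this) (τ x)
    rw [hτ x] at h2
    have h3 : (l : ℝ) * dist x y * |τ x| ≤ l * dist x y * (L / 2) :=
      mul_le_mul_of_nonneg_left (hτbound x) (by positivity)
    have h4 := abs_add_le ((∫ s in (0 : ℝ)..τ x, g (y + Pi.single i s)) - P x) (P x - P y)
    rw [sub_add_sub_cancel] at h4
    linarith [hPdist x y]
  have hη : 2 * L * l ≤ 1 / 2 := by linarith
  set H : (ι → ℝ) → ι → ℝ := fun x => x + Pi.single i (τ x) with hHdef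
  have hdiff : ∀ x y, dist (H x - H y) (x - y) ≤ 2 * L * l * dist x y := fun x y => by
    have : H x - H y - (x - y) = Pi.single i (τ x) - Pi.single i (τ y) := by
      simp only [hHdef]; abel
    rw [dist_eq_norm, this, ← dist_eq_norm]
    exact (dist_single_le i _ _).trans (hτdist x y)
  set c : ℝ≥0 := 2 * L.toNNReal * l with hc
  have hcr : (c : ℝ) = 2 * L * l := by simp [hc, hL.le]
  have happ : ApproximatesLinearOn H ((ContinuousLinearEquiv.refl ℝ (ι → ℝ) : _ ≃L[ℝ] _) :
      (ι → ℝ) →L[ℝ] (ι → ℝ)) univ c := by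
    intro x _ y _
    have := hdiff x y
    rw [dist_eq_norm, dist_eq_norm] at this
    rw [hcr]
    simpa using this
  have hcond : Subsingleton (ι → ℝ) ∨
      c < ‖((ContinuousLinearEquiv.refl ℝ (ι → ℝ)).symm : (ι → ℝ) →L[ℝ] (ι → ℝ))‖₊⁻¹ := by
    right
    have : Nonempty ι := ⟨i⟩
    have h1 : ‖((ContinuousLinearEquiv.refl ℝ (ι → ℝ)).symm : (ι → ℝ) →L[ℝ] (ι → ℝ))‖₊ = 1 := by
      rw [ContinuousLinearEquiv.refl_symm, ContinuousLinearEquiv.coe_refl]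
      exact ContinuousLinearMap.nnnorm_id
    rw [h1, inv_one, ← NNReal.coe_lt_coe, hcr, NNReal.coe_one]
    linarith
  have hHup : ∀ x y, dist (H x) (H y) ≤ (1 + 2 * L * l) * dist x y := fun x y => by
    have h := hdiff x y
    rw [dist_eq_norm] at h
    have := norm_add_le (H x - H y - (x - y)) (x - y)
    rw [sub_add_cancel, ← dist_eq_norm (H x), ← dist_eq_norm x] at this
    linarith
  have hHlow : ∀ x y, (1 - 2 * L * l) * dist x y ≤ dist (H x) (H y) := fun x y => by
    have h := hdiff x y
    rw [dist_comm, dist_eq_norm] at h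
    have := norm_add_le (x - y - (H x - H y)) (H x - H y)
    rw [sub_add_cancel, ← dist_eq_norm x, ← dist_eq_norm (H x)] at this
    linarith
  have hη0 : 0 ≤ 2 * L * l := by positivity
  have hKr : ((1 + 4 * L.toNNReal * l : ℝ≥0) : ℝ) = 1 + 4 * L * l := by simp [hL.le]
  refine ⟨happ.toHomeomorph H hcond, ?_, ?_, ?_⟩
  · refine LipschitzWith.of_dist_le_mul fun x y => ?_
    rw [hKr]
    refine (hHup x y).trans (mul_le_mul_of_nonneg_right ?_ dist_nonneg)
    linarith
  · refine AntilipschitzWith.of_le_mul_dist fun x y => ?_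
    rw [hKr]
    have h1 := hHlow x y
    have h2 : (1 + 4 * L * l) * ((1 - 2 * L * l) * dist x y) ≤ (1 + 4 * L * l) * dist (H x) (H y) :=
      mul_le_mul_of_nonneg_left h1 (by linarith)
    have h3 : (1 : ℝ) * dist x y ≤ (1 + 4 * L * l) * (1 - 2 * L * l) * dist x y :=
      mul_le_mul_of_nonneg_right (by nlinarith) dist_nonneg
    change dist x y ≤ (1 + 4 * L * l) * dist (H x) (H y)
    linarith
  change Measure.map H _ = _
  have hHc : Continuous H := by
    have : LipschitzWith (1 + c) H := LipschitzWith.of_dist_le_mul fun x y => by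
      push_cast; rw [hcr]; exact hHup x y
    exact this.continuous
  have hHsurj : Function.Surjective H := (happ.toHomeomorph H hcond).surjective
  set h : (ι → ℝ) → ℝ → ℝ := fun x t => t + τ (Function.update x i t) with hh
  have hus : ∀ (x : ι → ℝ) (t s : ℝ), Function.update x i t + Pi.single i s = Function.update x i (t + s) := by
    intro x t s
    ext j
    by_cases hj : j = i
    · subst hj; simp
    · simp [hj]
  have hHh : ∀ x t, H (Function.update x i t) = Function.update x i (h x t) := fun x t => by
    simp only [hHdef, hh, hus]
  have hupd : ∀ x : ι → ℝ, Continuous fun t : ℝ => Function.update x i t :=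
    fun x => continuous_const.update i continuous_id
  have hhc : ∀ x, Continuous (h x) := fun x => by
    have : h x = fun t => H (Function.update x i t) i := by
      funext t; simp [hHh]
    rw [this]; exact (continuous_apply i).comp (hHc.comp (hupd x))
  refine map_withDensity_eq_of_lines hfc hgc i hHc h hHh fun x => ?_
  refine map_withDensity_eq_of_intervalIntegral_eq (hfc.comp (hupd x)) (hgc.comp (hupd x))
    (fun t => le_trans (by norm_num) (hfhalf _))
    (fun t => le_trans (by norm_num) (hghalf _)) (hhc x) ?_ ?_ ?_
  · intro a b hab
    have h1 := hτdist (Function.update x i a) (Function.update x i b)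
    have h2 : dist (Function.update x i a) (Function.update x i b) ≤ b - a := by
      rw [← abs_of_pos (sub_pos.2 hab), abs_sub_comm]
      rw [dist_pi_le_iff (abs_nonneg _)]
      intro j
      by_cases hj : j = i
      · subst hj; simp [Real.dist_eq]
      · simp [hj]
    have h3 : 2 * L * l * dist (Function.update x i a) (Function.update x i b) ≤ 1 / 2 * (b - a) :=
      mul_le_mul hη h2 dist_nonneg (by norm_num)
    have h4 := (abs_le.1 (h1.trans h3)).2
    simp only [hh]
    linarith
  · intro t
    obtain ⟨y, hy⟩ := hHsurj (Function.update x i t)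
    refine ⟨y i, ?_⟩
    have hyx : y = Function.update x i (y i) := by
      ext j
      by_cases hj : j = i
      · subst hj; simp
      · have := congrFun hy j
        simpa [hHdef, hj] using this
    have := congrFun hy i
    rw [hyx, hHh] at this
    simpa using this
  · intro a b hab
    set fx : ℝ → ℝ := fun t => f (Function.update x i t) with hfx'
    have hfxc : Continuous fx := hfc.comp (hupd x)
    have hii : ∀ a b, IntervalIntegrable fx volume a b := fun a b => hfxc.intervalIntegrable a b
    have hgfx : ∀ t, g (Function.update x i t) = (fx t + fx (t + L)) / 2 := fun t => by
      simp only [hgdef, hus, hfx']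
    set gx : ℝ → ℝ := fun t => g (Function.update x i t) with hgx'
    have hgxc : Continuous gx := hgc.comp (hupd x)
    have hgi : ∀ a b, IntervalIntegrable gx volume a b := fun a b => hgxc.intervalIntegrable a b
    have hP : ∀ t, P (Function.update x i t) = (L - ∫ s in t..t + L, fx s) / 2 := fun t => by
      have hft : Continuous fun s => fx (t + s) := hfxc.comp (continuous_const.add continuous_id)
      have := intervalIntegral.integral_comp_add_left (a := 0) (b := L) fx t
      rw [add_zero] at this
      simp only [hPdef, hus]
      change (∫ s in (0 : ℝ)..L, (1 - fx (t + s))) / 2 = _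
      rw [intervalIntegral.integral_sub (by simp) (hft.intervalIntegrable _ _), this]
      simp
    have hτ' : ∀ t, ∫ s in t..h x t, gx s = P (Function.update x i t) := fun t => by
      have := hτ (Function.update x i t)
      simp only [hus] at this
      rw [← this]
      have := intervalIntegral.integral_comp_add_left (a := 0) (b := τ (Function.update x i t)) gx t
      rw [add_zero] at this
      simp only [hh]
      rw [← this]
    change ∫ t in h x a..h x b, gx t = ∫ t in a..b, fx t
    have e1 : ∫ t in h x a..h x b, gx t = (∫ t in a..b, gx t) + P (Function.update x i b)
        - P (Function.update x i a) := by
      rw [← hτ' a, ← hτ' b]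
      rw [intervalIntegral.integral_add_adjacent_intervals (hgi _ _) (hgi _ _),
        intervalIntegral.integral_interval_sub_left (hgi _ _) (hgi _ _)]
    have e2 : ∫ t in a..b, gx t = ((∫ t in a..b, fx t) + ∫ t in a + L..b + L, fx t) / 2 := by
      have hfL : Continuous fun s => fx (s + L) := hfxc.comp (continuous_id.add continuous_const)
      rw [show gx = fun t => (fx t + fx (t + L)) / 2 from funext hgfx,
        intervalIntegral.integral_div, intervalIntegral.integral_add (hii _ _)
          (hfL.intervalIntegrable _ _),
        intervalIntegral.integral_comp_add_right fx L]
    have e3 : (∫ s in a..b, fx s) + ∫ s in b..b + L, fx s =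
        (∫ s in a..a + L, fx s) + ∫ s in a + L..b + L, fx s := by
      rw [intervalIntegral.integral_add_adjacent_intervals (hii _ _) (hii _ _),
        intervalIntegral.integral_add_adjacent_intervals (hii _ _) (hii _ _)]
    rw [e1, e2, hP, hP]
    linarith

end Step

/-- A function of boxes, given by their lower corner and their side lengths, is additive if it is
additive under cutting a box in two by a hyperplane orthogonal to a coordinate axis. -/
def BoxAdditive {ι : Type*} [DecidableEq ι] (β : (ι → ℝ) → (ι → ℝ) → ℝ) : Prop :=
  ∀ (a l : ι → ℝ) (i : ι) (s t : ℝ), (∀ j, 0 ≤ l j) → 0 ≤ s → 0 ≤ t →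
    β a (Function.update l i (s + t)) =
      β a (Function.update l i s) + β (a + Pi.single i s) (Function.update l i t)

section Box
variable {ι : Type*} [Fintype ι] [DecidableEq ι]

theorem boxAdditive_prod : BoxAdditive fun _ l : ι → ℝ => ∏ i, l i := by
  intro a l i s t _ _ _
  simp only [Finset.prod_update_of_mem (Finset.mem_univ i)]
  ring

theorem BoxAdditive.sub {ι : Type*} [DecidableEq ι] {β γ : (ι → ℝ) → (ι → ℝ) → ℝ}
    (hβ : BoxAdditive β) (hγ : BoxAdditive γ) :
    BoxAdditive fun a l => β a l - γ a l := by
  intro a l i s t hl hs ht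
  simp only [hβ a l i s t hl hs ht, hγ a l i s t hl hs ht]
  ring

theorem BoxAdditive.const_mul {ι : Type*} [DecidableEq ι] {β : (ι → ℝ) → (ι → ℝ) → ℝ}
    (hβ : BoxAdditive β) (c : ℝ) :
    BoxAdditive fun a l => c * β a l := by
  intro a l i s t hl hs ht
  simp only [hβ a l i s t hl hs ht]
  ring

/-- Additive functions which are nonnegative on the boxes with sides in `[L, 2 * L]` are
nonnegative on all boxes with sides at least `L`. -/
theorem BoxAdditive.nonneg_of_small {β : (ι → ℝ) → (ι → ℝ) → ℝ} (hβ : BoxAdditive β) {L : ℝ}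
    (hL : 0 < L) (h : ∀ a l, (∀ i, L ≤ l i) → (∀ i, l i ≤ 2 * L) → 0 ≤ β a l)
    (a l : ι → ℝ) (hl : ∀ i, L ≤ l i) : 0 ≤ β a l := by
  suffices H : ∀ (s : Finset ι) (a l : ι → ℝ), (∀ i, L ≤ l i) → (∀ i, i ∉ s → l i ≤ 2 * L) →
      0 ≤ β a l from H Finset.univ a l hl fun i hi => absurd (Finset.mem_univ i) hi
  intro s
  induction s using Finset.induction_on with
  | empty => exact fun a l h1 h2 => h a l h1 fun i => h2 i (Finset.notMem_empty i)
  | insert i s _ ih =>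
    have key : ∀ (n : ℕ) (a l : ι → ℝ), (∀ i, L ≤ l i) → (∀ j, j ∉ insert i s → l j ≤ 2 * L) →
        l i ≤ 2 ^ n * (2 * L) → 0 ≤ β a l := by
      intro n
      induction n with
      | zero =>
        intro a l h1 h2 h3
        refine ih a l h1 fun j hj => ?_
        by_cases hji : j = i
        · subst hji; simpa using h3
        · exact h2 j (by simp [hj, hji])
      | succ n ihn =>
        intro a l h1 h2 h3
        by_cases h4 : l i ≤ 2 * L
        · refine ih a l h1 fun j hj => ?_
          by_cases hji : j = i
          · subst hji; exact h4
          · exact h2 j (by simp [hj, hji])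
        push Not at h4
        have hcut := hβ a l i (l i / 2) (l i / 2) (fun j => hL.le.trans (h1 j))
          (by linarith) (by linarith)
        rw [add_halves, Function.update_eq_self] at hcut
        have hside : ∀ j, L ≤ Function.update l i (l i / 2) j := fun j => by
          by_cases hji : j = i
          · subst hji; rw [Function.update_self]; linarith
          · rw [Function.update_of_ne hji]; exact h1 j
        have hside' : ∀ j, j ∉ insert i s → Function.update l i (l i / 2) j ≤ 2 * L :=
          fun j hj => by
            have hji : j ≠ i := fun e => hj (by simp [e])
            rw [Function.update_of_ne hji]; exact h2 j hj
        have hside'' : Function.update l i (l i / 2) i ≤ 2 ^ n * (2 * L) := by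
          rw [Function.update_self]; rw [pow_succ] at h3; linarith
        rw [hcut]
        exact add_nonneg (ihn _ _ hside hside' hside'') (ihn _ _ hside hside' hside'')
    intro a l h1 h2
    obtain ⟨n, hn⟩ := pow_unbounded_of_one_lt (l i / (2 * L)) (one_lt_two : (1 : ℝ) < 2)
    exact key n a l h1 h2 (by rw [div_lt_iff₀ (by positivity)] at hn; exact hn.le)

/-- Monotonicity of an additive function on boxes that lie well inside a larger box. -/
theorem BoxAdditive.le_of_inner {β : (ι → ℝ) → (ι → ℝ) → ℝ} (hβ : BoxAdditive β) {L : ℝ}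
    (hL : 0 < L) (h : ∀ a l, (∀ i, L ≤ l i) → 0 ≤ β a l) {a l a' l' : ι → ℝ}
    (h1 : ∀ i, a i + L ≤ a' i) (h2 : ∀ i, a' i + l' i + L ≤ a i + l i) (h3 : ∀ i, L ≤ l' i) :
    β a' l' ≤ β a l := by
  suffices H : ∀ s : Finset ι, β (s.piecewise a' a) (s.piecewise l' l) ≤ β a l by
    simpa using H Finset.univ
  have hl : ∀ i, L ≤ l i := fun i => by linarith [h1 i, h2 i, h3 i]
  intro s
  induction s using Finset.induction_on with
  | empty => simp
  | insert i s his ih =>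
    refine le_trans ?_ ih
    set A := s.piecewise a' a with hA
    set Λ := s.piecewise l' l with hΛ
    have hAi : A i = a i := by simp [hA, his]
    have hΛi : Λ i = l i := by simp [hΛ, his]
    have hΛL : ∀ j, L ≤ Λ j := fun j => by
      by_cases hj : j ∈ s
      · simpa [hΛ, hj] using h3 j
      · simpa [hΛ, hj] using hl j
    have hΛ0 : ∀ j, 0 ≤ Λ j := fun j => hL.le.trans (hΛL j)
    have hup : ∀ {u : ℝ}, L ≤ u → ∀ j, L ≤ Function.update Λ i u j := fun {u} hu j => by
      by_cases hji : j = i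
      · subst hji; rwa [Function.update_self]
      · rw [Function.update_of_ne hji]; exact hΛL j
    set u := a' i - a i with hu
    set w := a i + l i - a' i - l' i with hw
    have hLu : L ≤ u := by linarith [h1 i]
    have hLw : L ≤ w := by linarith [h2 i]
    have e1 := hβ A Λ i u (l' i + w) hΛ0 (by linarith) (by linarith [h3 i])
    have e2 := hβ (A + Pi.single i u) Λ i (l' i) w hΛ0 (by linarith [h3 i]) (by linarith)
    have e3 : u + (l' i + w) = Λ i := by rw [hΛi]; ring
    rw [e3, Function.update_eq_self] at e1
    have e4 : A + Pi.single i u = Function.update A i (a' i) := by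
      ext j
      by_cases hji : j = i
      · subst hji; simp [hAi, hu]
      · simp [hji]
    rw [Finset.piecewise_insert, Finset.piecewise_insert, ← hA, ← hΛ, ← e4, e1, e2]
    linarith [h A _ (hup hLu), h (A + Pi.single i u + Pi.single i (l' i)) _ (hup hLw)]

/-- On boxes with sides at least `L`, the density of `N` lies between `lo` and `up`. -/
def DensityBounds (N : (ι → ℝ) → (ι → ℝ) → ℝ) (L lo up : ℝ) : Prop :=
  ∀ a l : ι → ℝ, (∀ i, L ≤ l i) → lo * ∏ i, l i ≤ N a l ∧ N a l ≤ up * ∏ i, l i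

/-- Every box with sides in `[L, 2 * L]` has a copy well inside any box with sides at least
`κ * L`. -/
def BoxRepetitive (N : (ι → ℝ) → (ι → ℝ) → ℝ) (L₀ κ : ℝ) : Prop :=
  ∀ L, L₀ ≤ L → ∀ a l : ι → ℝ, (∀ i, L ≤ l i) → (∀ i, l i ≤ 2 * L) →
    ∀ b m : ι → ℝ, (∀ i, κ * L ≤ m i) →
      ∃ a', N a' l = N a l ∧ (∀ i, b i + L ≤ a' i) ∧ ∀ i, a' i + l i + L ≤ b i + m i

theorem DensityBounds.le {ι : Type*} [Fintype ι] {N : (ι → ℝ) → (ι → ℝ) → ℝ}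
    {L L' lo up lo' up' : ℝ} (hL : 0 < L) (h : DensityBounds N L lo up) (h' : DensityBounds N L' lo' up') : lo ≤ up' := by
  have hpos : 0 < ∏ _i : ι, max L L' := Finset.prod_pos fun _ _ => lt_max_of_lt_left hL
  have h1 := (h 0 (fun _ => max L L') fun _ => le_max_left _ _).1
  have h2 := (h' 0 (fun _ => max L L') fun _ => le_max_right _ _).2
  exact le_of_mul_le_mul_right (h1.trans h2) hpos

theorem DensityBounds.improve {N : (ι → ℝ) → (ι → ℝ) → ℝ} (hN : BoxAdditive N) {L₀ κ L lo up : ℝ}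
    (hκ : 1 ≤ κ) (hrep : BoxRepetitive N L₀ κ) (hL : 0 < L) (hL₀ : L₀ ≤ L)
    (h : DensityBounds N L lo up) :
    ∃ lo' up', DensityBounds N (κ * L) lo' up' ∧
      up' - lo' ≤ (1 - (1 / (2 * κ)) ^ Fintype.card ι / 2) * (up - lo) := by
  have hlu : lo ≤ up := h.le hL h
  set θ := (1 / (2 * κ)) ^ Fintype.card ι with hθ
  have hθ0 : 0 ≤ θ := by positivity
  have hθ1 : θ ≤ 1 := pow_le_one₀ (by positivity) (by rw [div_le_one] <;> linarith)
  have hLκ : L ≤ κ * L := by nlinarith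
  by_cases hcase : ∃ a l : ι → ℝ, (∀ i, L ≤ l i) ∧ (∀ i, l i ≤ 2 * L) ∧
      N a l ≤ (lo + up) / 2 * ∏ i, l i
  · obtain ⟨a, l, hl1, hl2, hNal⟩ := hcase
    refine ⟨lo, up - θ / 2 * (up - lo), fun b m hm => ⟨(h b m fun i => hLκ.trans (hm i)).1, ?_⟩,
      by linarith⟩
    have hup : BoxAdditive fun a l : ι → ℝ => up * ∏ i, l i - N a l :=
      (boxAdditive_prod.const_mul up).sub hN
    have hup' : BoxAdditive fun a l : ι → ℝ => (up - θ / 2 * (up - lo)) * ∏ i, l i - N a l :=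
      (boxAdditive_prod.const_mul _).sub hN
    refine sub_nonneg.1 (hup'.nonneg_of_small (L := κ * L) (by positivity) ?_ b m hm)
    intro b m hm1 hm2
    obtain ⟨a', ha', h1, h2⟩ := hrep L hL₀ a l hl1 hl2 b m hm1
    have h3 := hup.le_of_inner hL
      (fun a l hl => sub_nonneg.2 (h a l hl).2) h1 h2 hl1
    simp only [ha'] at h3
    have h4 : θ * ∏ i, m i ≤ ∏ i, l i := by
      have : θ * ∏ i, m i = ∏ i, (1 / (2 * κ) * m i) := by
        rw [Finset.prod_mul_distrib, Finset.prod_const, Finset.card_univ]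
      rw [this]
      refine Finset.prod_le_prod (fun i _ => ?_) fun i _ => ?_
      · have : 0 ≤ m i := le_trans (by positivity) (hm1 i)
        positivity
      · refine le_trans ?_ (hl1 i)
        rw [one_div, inv_mul_le_iff₀ (by positivity)]
        linarith [hm2 i]
    have h5 := mul_le_mul_of_nonneg_left h4 (by linarith : 0 ≤ (up - lo) / 2)
    nlinarith
  · push Not at hcase
    refine ⟨(lo + up) / 2, up, fun b m hm => ⟨?_, (h b m fun i => hLκ.trans (hm i)).2⟩, ?_⟩
    · have hlo : BoxAdditive fun a l : ι → ℝ => N a l - (lo + up) / 2 * ∏ i, l i :=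
        hN.sub (boxAdditive_prod.const_mul _)
      exact sub_nonneg.1 (hlo.nonneg_of_small hL
        (fun a l h1 h2 => sub_nonneg.2 (hcase a l h1 h2).le) b m fun i => hLκ.trans (hm i))
    · nlinarith

theorem exists_density {N : (ι → ℝ) → (ι → ℝ) → ℝ} (hN : BoxAdditive N) {L₀ lo up : ℝ} {k : ℕ}
    (hL₀ : 0 < L₀) (hrep : BoxRepetitive N L₀ (2 ^ (k + 1))) (hlo : 0 < lo)
    (h : DensityBounds N L₀ lo up) :
    ∃ δ : ℝ, 0 < δ ∧ ∃ e : ℕ → ℝ, Summable e ∧ (∀ n, 0 ≤ e n) ∧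
      ∀ (n : ℕ) (a l : ι → ℝ), (∀ i, 2 ^ n * L₀ ≤ l i) →
        |N a l / δ - ∏ i, l i| ≤ e n * ∏ i, l i := by
  set κ : ℝ := 2 ^ (k + 1) with hκ
  have hκ1 : 1 ≤ κ := one_le_pow₀ one_le_two
  set ρ : ℝ := 1 - (1 / (2 * κ)) ^ Fintype.card ι / 2 with hρ
  have hθ1 : (1 / (2 * κ)) ^ Fintype.card ι ≤ 1 :=
    pow_le_one₀ (by positivity) (by rw [div_le_one] <;> linarith)
  have hθ0 : 0 < (1 / (2 * κ)) ^ Fintype.card ι := by positivity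
  have hρ0 : 0 < ρ := by linarith
  have hρ1 : ρ < 1 := by linarith
  have hseq : ∀ n : ℕ, ∃ lo' up', DensityBounds N (κ ^ n * L₀) lo' up' ∧
      up' - lo' ≤ ρ ^ n * (up - lo) := by
    intro n
    induction n with
    | zero => exact ⟨lo, up, by simpa using h, by simp⟩
    | succ n ih =>
      obtain ⟨lo', up', h1, h2⟩ := ih
      obtain ⟨lo'', up'', h3, h4⟩ := h1.improve hN hκ1 hrep (by positivity)
        (by nlinarith [one_le_pow₀ hκ1 (n := n)])
      refine ⟨lo'', up'', by rwa [pow_succ', mul_assoc], h4.trans ?_⟩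
      rw [pow_succ', mul_assoc]
      exact mul_le_mul_of_nonneg_left h2 hρ0.le
  set S : Set ℝ := {x | ∃ L y, 0 < L ∧ DensityBounds N L x y} with hS
  have hSbdd : ∀ {L lo' up' : ℝ}, DensityBounds N L lo' up' → ∀ x ∈ S, x ≤ up' := by
    rintro L lo' up' h1 x ⟨L', y, hL', h2⟩
    exact h2.le hL' h1
  set δ := sSup S with hδ
  have hδlo : ∀ {L lo' up' : ℝ}, 0 < L → DensityBounds N L lo' up' → lo' ≤ δ :=
    fun {L lo' up'} hL h1 => le_csSup ⟨up, hSbdd h⟩ ⟨L, up', hL, h1⟩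
  have hδup : ∀ {L lo' up' : ℝ}, 0 < L → DensityBounds N L lo' up' → δ ≤ up' :=
    fun {L lo' up'} hL h1 => csSup_le ⟨lo', L, up', hL, h1⟩ (hSbdd h1)
  have hδ0 : 0 < δ := hlo.trans_le (hδlo hL₀ h)
  have hlu : lo ≤ up := h.le hL₀ h
  refine ⟨δ, hδ0, fun n => ρ ^ (n / (k + 1)) * ((up - lo) / δ), ?_, fun n => ?_, ?_⟩
  · refine Summable.mul_right _ ?_
    set σ : ℝ := ρ ^ (1 / ((k + 1 : ℕ) : ℝ)) with hσ
    have hσ0 : 0 ≤ σ := by positivity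
    have hσ1 : σ < 1 := Real.rpow_lt_one hρ0.le hρ1 (by positivity)
    have hσk : σ ^ (k + 1) = ρ := by
      rw [hσ, one_div]
      exact Real.rpow_inv_natCast_pow hρ0.le (Nat.succ_ne_zero k)
    refine Summable.of_nonneg_of_le (fun n => by positivity) (fun n => ?_)
      ((summable_geometric_of_lt_one hσ0 hσ1).mul_left ρ⁻¹)
    rw [le_inv_mul_iff₀ hρ0, ← pow_succ', ← hσk, ← pow_mul]
    refine pow_le_pow_of_le_one hσ0 hσ1.le ?_
    exact (Nat.lt_mul_div_succ n (Nat.succ_pos k)).le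
  · have : 0 ≤ up - lo := by linarith
    positivity
  · intro n a l hl
    obtain ⟨lo', up', h1, h2⟩ := hseq (n / (k + 1))
    have hpos : (0 : ℝ) < κ ^ (n / (k + 1)) * L₀ := by positivity
    have hle : κ ^ (n / (k + 1)) * L₀ ≤ 2 ^ n * L₀ := by
      refine mul_le_mul_of_nonneg_right ?_ hL₀.le
      rw [hκ, ← pow_mul]
      exact pow_le_pow_right₀ one_le_two (Nat.mul_div_le n (k + 1))
    obtain ⟨h3, h4⟩ := h1 a l fun i => hle.trans (hl i)
    have h5 := hδlo hpos h1
    have h6 := hδup hpos h1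
    have hprod : 0 ≤ ∏ i, l i := Finset.prod_nonneg fun i _ => le_trans (by positivity) (hl i)
    have h7 : |N a l - δ * ∏ i, l i| ≤ ρ ^ (n / (k + 1)) * (up - lo) * ∏ i, l i := by
      refine le_trans ?_ (mul_le_mul_of_nonneg_right h2 hprod)
      rw [abs_le]
      constructor <;> nlinarith
    have h8 : N a l / δ - ∏ i, l i = (N a l - δ * ∏ i, l i) / δ := by field_simp
    rw [h8, abs_div, abs_of_pos hδ0, div_le_iff₀ hδ0]
    refine h7.trans (le_of_eq ?_)
    field_simp

end Box

/-- The half-open box with lower corner `a` and side lengths `l`. -/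
def box {ι : Type*} (a l : ι → ℝ) : Set (ι → ℝ) :=
  univ.pi fun i => Ico (a i) (a i + l i)

theorem mem_box {ι : Type*} {a l x : ι → ℝ} :
    x ∈ box a l ↔ ∀ i, a i ≤ x i ∧ x i < a i + l i := by
  simp [box]

theorem box_update_add {ι : Type*} [DecidableEq ι] (a l : ι → ℝ) (i : ι) {s t : ℝ} (hs : 0 ≤ s)
    (ht : 0 ≤ t) : box a (Function.update l i (s + t)) =
      box a (Function.update l i s) ∪ box (a + Pi.single i s) (Function.update l i t) := by
  ext x
  simp only [mem_union, mem_box]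
  constructor
  · intro h
    by_cases hx : x i < a i + s
    · refine Or.inl fun j => ?_
      by_cases hji : j = i
      · subst hji; simpa using ⟨(h j).1, hx⟩
      · simpa [hji] using h j
    · refine Or.inr fun j => ?_
      by_cases hji : j = i
      · subst hji
        have := (h j).2
        simp only [Function.update_self] at this
        simp only [Pi.add_apply, Pi.single_eq_same, Function.update_self]
        constructor <;> linarith
      · simpa [hji] using h j
  · rintro (h | h) j
    · by_cases hji : j = i
      · subst hji
        have := h j
        simp only [Function.update_self] at this ⊢
        constructor <;> linarith
      · simpa [hji] using h j
    · by_cases hji : j = i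
      · subst hji
        have := h j
        simp only [Pi.add_apply, Pi.single_eq_same, Function.update_self] at this ⊢
        constructor <;> linarith
      · simpa [hji] using h j

theorem disjoint_box_update {ι : Type*} [DecidableEq ι] (a l : ι → ℝ) (i : ι) (s t : ℝ) :
    Disjoint (box a (Function.update l i s)) (box (a + Pi.single i s) (Function.update l i t)) := by
  rw [Set.disjoint_left]
  intro x h1 h2
  have h1 := (mem_box.1 h1 i).2
  have h2 := (mem_box.1 h2 i).1
  simp only [Pi.add_apply, Pi.single_eq_same, Function.update_self] at h1 h2
  linarith

theorem add_mem_box_add {ι : Type*} {a l x v : ι → ℝ} : x + v ∈ box (a + v) l ↔ x ∈ box a l := by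
  simp only [mem_box, Pi.add_apply]
  refine forall_congr' fun i => ?_
  constructor <;> rintro ⟨h1, h2⟩ <;> constructor <;> linarith

section Smoothing
variable {ι : Type*} [Fintype ι]

theorem measurableSet_box (a l : ι → ℝ) : MeasurableSet (box a l) :=
  MeasurableSet.univ_pi fun _ => measurableSet_Ico

theorem volume_box {a l : ι → ℝ} (hl : ∀ i, 0 ≤ l i) :
    volume (box a l) = ENNReal.ofReal (∏ i, l i) := by
  rw [box, Real.volume_pi_Ico, ENNReal.ofReal_prod_of_nonneg fun i _ => hl i]
  simp

theorem measure_box_lt_top (ν : Measure (ι → ℝ)) [IsLocallyFiniteMeasure ν] (a l : ι → ℝ) :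
    ν (box a l) < ∞ := by
  refine (measure_mono (t := Icc a (a + l)) fun x hx => ?_).trans_lt isCompact_Icc.measure_lt_top
  exact ⟨fun i => (mem_box.1 hx i).1, fun i => (mem_box.1 hx i).2.le⟩

theorem measurableSet_mem_box (l : ι → ℝ) :
    MeasurableSet {q : (ι → ℝ) × (ι → ℝ) | q.2 ∈ box q.1 l} := by
  have : {q : (ι → ℝ) × (ι → ℝ) | q.2 ∈ box q.1 l} =
      ⋂ i, ({q | q.1 i ≤ q.2 i} ∩ {q | q.2 i < q.1 i + l i}) := by
    ext q
    simp [mem_box]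
  rw [this]
  exact MeasurableSet.iInter fun i =>
    (measurableSet_le (by fun_prop) (by fun_prop)).inter
      (measurableSet_lt (by fun_prop) (by fun_prop))

theorem measurable_measure_box (ν : Measure (ι → ℝ)) [SFinite ν] (l : ι → ℝ) :
    Measurable fun a => ν (box a l) :=
  measurable_measure_prodMk_left (measurableSet_mem_box l)

theorem lintegral_measure_box (ν : Measure (ι → ℝ)) [SFinite ν] {l : ι → ℝ} (hl : ∀ i, 0 ≤ l i) :
    ∫⁻ a, ν (box a l) = ENNReal.ofReal (∏ i, l i) * ν univ := by
  have h1 := Measure.prod_apply (μ := volume) (ν := ν) (measurableSet_mem_box l)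
  have h2 := Measure.prod_apply_symm (μ := volume) (ν := ν) (measurableSet_mem_box l)
  have h3 : ∀ p : ι → ℝ, volume ((fun a : ι → ℝ => (a, p)) ⁻¹' {q | q.2 ∈ box q.1 l}) =
      ENNReal.ofReal (∏ i, l i) := fun p => by
    have : (fun a : ι → ℝ => (a, p)) ⁻¹' {q | q.2 ∈ box q.1 l} =
        univ.pi fun i => Ioc (p i - l i) (p i) := by
      ext a
      simp only [mem_preimage, mem_ofPred_eq, mem_box, mem_univ_pi, mem_Ioc, sub_lt_iff_lt_add]
      exact forall_congr' fun i => and_comm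
    rw [this, volume_pi_pi, ENNReal.ofReal_prod_of_nonneg fun i _ => hl i]
    simp
  simp only [h3, lintegral_const] at h2
  rw [← h2, h1]
  rfl

/-- The mean value of `h` on the box with lower corner `x` and side lengths `l`. -/
noncomputable def boxMean (l : ι → ℝ) (h : (ι → ℝ) → ℝ) (x : ι → ℝ) : ℝ :=
  (∫ y in box x l, h y) / ∏ i, l i

theorem boxMean_half_add {l : ι → ℝ} {h : (ι → ℝ) → ℝ}
    (hi : ∀ x, IntegrableOn h (box x l)) (v x : ι → ℝ) :
    boxMean l (fun y => (h y + h (y + v)) / 2) x = (boxMean l h x + boxMean l h (x + v)) / 2 := by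
  have hpre : (fun y => y + v) ⁻¹' box (x + v) l = box x l := by
    ext y; exact add_mem_box_add
  have hmp := measurePreserving_add_right (volume : Measure (ι → ℝ)) v
  have hme := (MeasurableEquiv.addRight v).measurableEmbedding
  have h1 : ∫ y in box x l, h (y + v) = ∫ y in box (x + v) l, h y := by
    rw [← hpre]; exact hmp.setIntegral_preimage_emb hme h _
  have h2 : IntegrableOn (fun y => h (y + v)) (box x l) := by
    rw [← hpre]; exact (hmp.integrableOn_comp_preimage hme).2 (hi _)
  simp only [boxMean]
  rw [integral_div, integral_add (hi x) h2, h1]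
  ring

theorem boxMean_update_two_mul [DecidableEq ι] {l : ι → ℝ} {h : (ι → ℝ) → ℝ} (hl : ∀ i, 0 < l i)
    (hi : ∀ x, IntegrableOn h (box x l)) (i : ι) (x : ι → ℝ) :
    boxMean (Function.update l i (2 * l i)) h x =
      (boxMean l h x + boxMean l h (x + Pi.single i (l i))) / 2 := by
  have h1 := box_update_add x l i (hl i).le (hl i).le
  have h2 := disjoint_box_update x l i (l i) (l i)
  have h3 := boxAdditive_prod x l i (l i) (l i) (fun j => (hl j).le) (hl i).le (hl i).le
  simp only [Function.update_eq_self] at h1 h2 h3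
  have hpos : 0 < ∏ j, l j := Finset.prod_pos fun j _ => hl j
  simp only [boxMean]
  rw [two_mul, h1, h3, setIntegral_union h2 (measurableSet_box _ _) (hi _) (hi _)]
  field_simp
  ring

theorem abs_setIntegral_le {g : (ι → ℝ) → ℝ} {e : ℝ} (hg : ∀ y, |g y| ≤ e)
    {s : Set (ι → ℝ)} (hs : volume s < ∞) : |∫ y in s, g y| ≤ e * volume.real s := by
  rw [← Real.norm_eq_abs]
  exact norm_setIntegral_le_of_norm_le_const hs fun y _ => (Real.norm_eq_abs _).trans_le (hg y)

theorem volume_box_diff_le {l : ι → ℝ} {L : ℝ} (hL : 0 < L) (hl : ∀ i, L ≤ l i) (x y : ι → ℝ) :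
    volume.real (box x l \ box y l) ≤ Fintype.card ι * (dist x y / L) * ∏ i, l i := by
  classical
  have hl0 : ∀ i, 0 ≤ l i := fun i => hL.le.trans (hl i)
  set I : ι → Set ℝ := fun i => Ico (x i) (x i + l i) with hI
  set J : ι → Set ℝ := fun i => I i \ Ico (y i) (y i + l i) with hJ
  have hsub : box x l \ box y l ⊆ ⋃ i, univ.pi (Function.update I i (J i)) := by
    rintro z ⟨hz1, hz2⟩
    rw [mem_box] at hz1 hz2
    push Not at hz2
    obtain ⟨i, hi⟩ := hz2
    refine mem_iUnion.2 ⟨i, fun j _ => ?_⟩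
    by_cases hji : j = i
    · subst hji
      rw [Function.update_self]
      exact ⟨hz1 j, fun h => absurd h.2 (not_lt.2 (hi h.1))⟩
    · rw [Function.update_of_ne hji]; exact hz1 j
  have hJv : ∀ i, volume (J i) ≤ ENNReal.ofReal (dist x y / L) * ENNReal.ofReal (l i) := fun i => by
    rw [← ENNReal.ofReal_mul (by positivity)]
    have h1 : volume (J i) ≤ ENNReal.ofReal |x i - y i| := by
      rcases le_total (x i) (y i) with hxy | hxy
      · have : J i ⊆ Ico (x i) (y i) := fun t ht => by
          refine ⟨ht.1.1, ?_⟩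
          by_contra hc
          exact ht.2 ⟨not_lt.1 hc, by linarith [ht.1.2]⟩
        refine (measure_mono this).trans ?_
        rw [Real.volume_Ico, abs_sub_comm, abs_of_nonneg (sub_nonneg.2 hxy)]
      · have : J i ⊆ Ico (y i + l i) (x i + l i) := fun t ht => by
          refine ⟨?_, ht.1.2⟩
          by_contra hc
          exact ht.2 ⟨by linarith [ht.1.1], not_le.1 hc⟩
        refine (measure_mono this).trans ?_
        rw [Real.volume_Ico, abs_of_nonneg (sub_nonneg.2 hxy)]
        simp
    refine h1.trans (ENNReal.ofReal_le_ofReal ?_)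
    have h2 : |x i - y i| ≤ dist x y := by
      rw [← Real.dist_eq]; exact dist_le_pi_dist x y i
    rw [div_mul_eq_mul_div, le_div_iff₀ hL]
    exact mul_le_mul h2 (hl i) hL.le dist_nonneg
  have hterm : ∀ i, volume (univ.pi (Function.update I i (J i))) ≤
      ENNReal.ofReal (dist x y / L * ∏ j, l j) := fun i => by
    rw [volume_pi_pi, ENNReal.ofReal_mul (by positivity),
      ENNReal.ofReal_prod_of_nonneg fun j _ => hl0 j,
      ← Finset.mul_prod_erase _ _ (Finset.mem_univ i), Function.update_self,
      ← Finset.mul_prod_erase _ (fun j => ENNReal.ofReal (l j)) (Finset.mem_univ i), ← mul_assoc]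
    refine mul_le_mul' (hJv i) (Finset.prod_le_prod' fun j hj => ?_)
    rw [Function.update_of_ne (Finset.ne_of_mem_erase hj)]
    simp [hI]
  have hsum := (measure_mono (μ := volume) hsub).trans
    ((measure_iUnion_fintype_le _ _).trans (Finset.sum_le_sum fun i _ => hterm i))
  rw [Finset.sum_const, Finset.card_univ, nsmul_eq_mul] at hsum
  have hprod : 0 ≤ ∏ i, l i := Finset.prod_nonneg fun i _ => hl0 i
  have := ENNReal.toReal_mono (by finiteness) hsum
  rw [ENNReal.toReal_mul, ENNReal.toReal_ofReal (by positivity)] at this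
  simpa [Measure.real, mul_assoc] using this

theorem abs_boxMean_sub_one_le {l : ι → ℝ} (hl : ∀ i, 0 < l i) {h : (ι → ℝ) → ℝ}
    (hi : ∀ x, IntegrableOn h (box x l)) {e : ℝ} (he : ∀ y, |h y - 1| ≤ e) (x : ι → ℝ) :
    |boxMean l h x - 1| ≤ e := by
  have hpos : 0 < ∏ j, l j := Finset.prod_pos fun j _ => hl j
  have hvol : volume.real (box x l) = ∏ j, l j := by
    rw [Measure.real, volume_box fun i => (hl i).le, ENNReal.toReal_ofReal hpos.le]
  have hfin := measure_box_lt_top volume x l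
  have h1 : boxMean l h x - 1 = (∫ y in box x l, (h y - 1)) / ∏ j, l j := by
    rw [integral_sub (hi x) (integrableOn_const hfin.ne), setIntegral_const, hvol]
    simp only [boxMean, smul_eq_mul, mul_one]
    field_simp
  rw [h1, abs_div, abs_of_pos hpos, div_le_iff₀ hpos, ← hvol]
  exact abs_setIntegral_le he hfin

theorem abs_boxMean_sub_le {l : ι → ℝ} {L : ℝ} (hL : 0 < L) (hl : ∀ i, L ≤ l i)
    {h : (ι → ℝ) → ℝ} (hi : ∀ x, IntegrableOn h (box x l)) {e : ℝ} (he : ∀ y, |h y - 1| ≤ e)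
    (x y : ι → ℝ) :
    |boxMean l h x - boxMean l h y| ≤ 2 * Fintype.card ι * e / L * dist x y := by
  have hl0 : ∀ i, 0 < l i := fun i => hL.trans_le (hl i)
  have hpos : 0 < ∏ j, l j := Finset.prod_pos fun j _ => hl0 j
  have he0 : 0 ≤ e := (abs_nonneg _).trans (he 0)
  have hvol : ∀ x, volume.real (box x l) = ∏ j, l j := fun x => by
    rw [Measure.real, volume_box fun i => (hl0 i).le, ENNReal.toReal_ofReal hpos.le]
  have hfin := fun x => measure_box_lt_top volume x l
  have hgi : ∀ x, IntegrableOn (fun y => h y - 1) (box x l) := fun x =>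
    (hi x).sub (integrableOn_const (hfin x).ne)
  have h1 : ∀ x, boxMean l h x = 1 + (∫ y in box x l, (h y - 1)) / ∏ j, l j := fun x => by
    rw [integral_sub (hi x) (integrableOn_const (hfin x).ne), setIntegral_const, hvol]
    simp only [boxMean, smul_eq_mul, mul_one]
    field_simp
    ring
  have hx := integral_inter_add_sdiff (measurableSet_box y l) (hgi x)
  have hy := integral_inter_add_sdiff (measurableSet_box x l) (hgi y)
  rw [inter_comm] at hy
  have hbd : ∀ x y, |∫ z in box x l \ box y l, (h z - 1)| ≤
      e * (Fintype.card ι * (dist x y / L) * ∏ i, l i) := fun x y =>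
    (abs_setIntegral_le he ((measure_mono sdiff_subset).trans_lt (hfin x))).trans
      (mul_le_mul_of_nonneg_left (volume_box_diff_le hL hl x y) he0)
  have hbx := abs_le.1 (hbd x y)
  have hby := abs_le.1 (hbd y x)
  rw [dist_comm y x] at hby
  have h2 : boxMean l h x - boxMean l h y = ((∫ z in box x l \ box y l, (h z - 1)) -
      ∫ z in box y l \ box x l, (h z - 1)) / ∏ j, l j := by
    rw [h1, h1, ← hx, ← hy]; ring
  have h3 : 2 * Fintype.card ι * e / L * dist x y * ∏ j, l j =
      2 * (e * (Fintype.card ι * (dist x y / L) * ∏ i, l i)) := by ring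
  rw [h2, abs_div, abs_of_pos hpos, div_le_iff₀ hpos, h3, abs_le]
  constructor <;> linarith [hbx.1, hbx.2, hby.1, hby.2]

theorem boxAdditive_measure [DecidableEq ι] (ν : Measure (ι → ℝ)) [IsLocallyFiniteMeasure ν] :
    BoxAdditive fun a l => ν.real (box a l) := by
  intro a l i s t _ hs ht
  simp only
  rw [box_update_add a l i hs ht, measureReal_union (disjoint_box_update a l i s t)
    (measurableSet_box _ _) (measure_box_lt_top ν _ _).ne (measure_box_lt_top ν _ _).ne]

end Smoothing

theorem BilipTransport.mono {ι : Type*} [Fintype ι] {K K' : ℝ≥0} {f g : (ι → ℝ) → ℝ}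
    (h : BilipTransport K f g) (hK : K ≤ K') : BilipTransport K' f g := by
  obtain ⟨H, h1, h2, h3⟩ := h
  exact ⟨H, h1.weaken hK, fun x y => (h2 x y).trans (by gcongr), h3⟩

/-- If doubling a side of the box `m` amounts to averaging `Φ m` with its translate by that side,
then doubling all sides of a cube transports `Φ` by a bi-Lipschitz map. -/
theorem bilipTransport_double {ι : Type*} [Fintype ι] [DecidableEq ι]
    {Φ : (ι → ℝ) → (ι → ℝ) → ℝ} {L : ℝ} (hL : 0 < L) {l : ℝ≥0} (hLl : L * l ≤ 1 / 4)
    (hΦ₁ : ∀ m : ι → ℝ, (∀ i, L ≤ m i) → ∀ x, |Φ m x - 1| ≤ 1 / 2)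
    (hΦl : ∀ m : ι → ℝ, (∀ i, L ≤ m i) → LipschitzWith l (Φ m))
    (hΦ : ∀ m : ι → ℝ, (∀ i, L ≤ m i) → ∀ i, Φ (Function.update m i (2 * m i)) =
      fun x => (Φ m x + Φ m (x + Pi.single i (m i))) / 2) :
    BilipTransport ((1 + 4 * L.toNNReal * l) ^ Fintype.card ι) (Φ fun _ => L)
      (Φ fun _ => 2 * L) := by
  suffices H : ∀ s : Finset ι, BilipTransport ((1 + 4 * L.toNNReal * l) ^ s.card) (Φ fun _ => L)
      (Φ fun i => if i ∈ s then 2 * L else L) by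
    simpa using H Finset.univ
  intro s
  induction s using Finset.induction_on with
  | empty => simpa using BilipTransport.refl (Φ fun _ => L)
  | insert i s hi ih =>
    rw [Finset.card_insert_of_notMem hi, pow_succ']
    refine ih.trans ?_
    set m : ι → ℝ := fun j => if j ∈ s then 2 * L else L with hm
    have hmL : ∀ j, L ≤ m j := fun j => by
      simp only [hm]; split_ifs <;> linarith
    have hmi : m i = L := if_neg hi
    have hup : (fun j => if j ∈ insert i s then 2 * L else L) =
        Function.update m i (2 * m i) := by
      funext j
      by_cases hji : j = i
      · subst hji; simp [hmi]
      · simp [hji, hm]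
    rw [hup, hΦ m hmL i, hmi]
    exact bilipTransport_average i hL (hΦ₁ m hmL) (hΦl m hmL) hLl

section Smoothing
variable {ι : Type*} [Fintype ι]

/-- The density of `ν`, relative to `δ` times the Lebesgue measure, of the box with sides `m`. -/
noncomputable def boxDensity (ν : Measure (ι → ℝ)) (δ : ℝ) (m y : ι → ℝ) : ℝ :=
  ν.real (box y m) / (δ * ∏ i, m i)

/-- For boxes with sides at least `L`, the relative discrepancy between `ν` and `δ` times the
Lebesgue measure is at most `e`. -/
def DiscrepancyLE (ν : Measure (ι → ℝ)) (δ L e : ℝ) : Prop :=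
  ∀ a l : ι → ℝ, (∀ i, L ≤ l i) → |ν.real (box a l) / δ - ∏ i, l i| ≤ e * ∏ i, l i

variable {ν : Measure (ι → ℝ)} {δ L e : ℝ}

theorem DiscrepancyLE.abs_boxDensity_sub_one_le (h : DiscrepancyLE ν δ L e) (hL : 0 < L)
    {m : ι → ℝ} (hm : ∀ i, L ≤ m i) (y : ι → ℝ) : |boxDensity ν δ m y - 1| ≤ e := by
  have hpos : 0 < ∏ j, m j := Finset.prod_pos fun j _ => hL.trans_le (hm j)
  have h1 := h y m hm
  have h2 : boxDensity ν δ m y - 1 = (ν.real (box y m) / δ - ∏ i, m i) / ∏ i, m i := by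
    rw [boxDensity, ← div_div]; field_simp
  rw [h2, abs_div, abs_of_pos hpos, div_le_iff₀ hpos]
  exact h1

theorem measurable_boxDensity [SFinite ν] (m : ι → ℝ) : Measurable (boxDensity ν δ m) :=
  (measurable_measure_box ν m).ennreal_toReal.div_const _

theorem DiscrepancyLE.integrableOn_boxDensity [SFinite ν] (h : DiscrepancyLE ν δ L e) (hL : 0 < L)
    {m : ι → ℝ} (hm : ∀ i, L ≤ m i) (l x : ι → ℝ) :
    IntegrableOn (boxDensity ν δ m) (box x l) := by
  refine Measure.integrableOn_of_bounded (M := 1 + e) (measure_box_lt_top volume x l).ne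
    (measurable_boxDensity m).aestronglyMeasurable (Eventually.of_forall fun y => ?_)
  have := abs_le.1 (h.abs_boxDensity_sub_one_le hL hm y)
  rw [Real.norm_eq_abs, abs_le]
  have h0 : (0:ℝ) ≤ e := (abs_nonneg _).trans (h.abs_boxDensity_sub_one_le hL hm y)
  constructor <;> linarith

/-- A Lipschitz approximation of the density of `ν`. -/
noncomputable def smoothDensity (ν : Measure (ι → ℝ)) (δ : ℝ) (l m : ι → ℝ) : (ι → ℝ) → ℝ :=
  boxMean l (boxDensity ν δ m)

theorem DiscrepancyLE.abs_smoothDensity_sub_one_le [SFinite ν] (h : DiscrepancyLE ν δ L e)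
    (hL : 0 < L) {l m : ι → ℝ} (hl : ∀ i, L ≤ l i) (hm : ∀ i, L ≤ m i) (x : ι → ℝ) :
    |smoothDensity ν δ l m x - 1| ≤ e :=
  abs_boxMean_sub_one_le (fun i => hL.trans_le (hl i)) (h.integrableOn_boxDensity hL hm l)
    (h.abs_boxDensity_sub_one_le hL hm) x

theorem DiscrepancyLE.lipschitzWith_smoothDensity [SFinite ν] (h : DiscrepancyLE ν δ L e)
    (hL : 0 < L) {l m : ι → ℝ} (hl : ∀ i, L ≤ l i) (hm : ∀ i, L ≤ m i) :
    LipschitzWith (2 * Fintype.card ι * e / L).toNNReal (smoothDensity ν δ l m) := by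
  have he : 0 ≤ e := (abs_nonneg _).trans (h.abs_boxDensity_sub_one_le hL hm 0)
  refine LipschitzWith.of_dist_le_mul fun x y => ?_
  rw [Real.coe_toNNReal _ (by positivity), Real.dist_eq]
  exact abs_boxMean_sub_le hL hl (h.integrableOn_boxDensity hL hm l)
    (h.abs_boxDensity_sub_one_le hL hm) x y

theorem boxDensity_update_two_mul [DecidableEq ι] [IsLocallyFiniteMeasure ν] {m : ι → ℝ}
    (hm : ∀ i, 0 < m i) (i : ι) :
    boxDensity ν δ (Function.update m i (2 * m i)) =
      fun y => (boxDensity ν δ m y + boxDensity ν δ m (y + Pi.single i (m i))) / 2 := by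
  funext y
  have h1 := boxAdditive_measure ν y m i (m i) (m i) (fun j => (hm j).le) (hm i).le (hm i).le
  have h3 := boxAdditive_prod y m i (m i) (m i) (fun j => (hm j).le) (hm i).le (hm i).le
  simp only [Function.update_eq_self] at h1 h3
  simp only [boxDensity]
  rw [two_mul, h1, h3]
  have : 0 < ∏ i, m i := Finset.prod_pos fun j _ => hm j
  by_cases hδ : δ = 0
  · simp [hδ]
  · field_simp; ring

/-- The smoothed densities at scales `L` and `2 * L` are related by a bi-Lipschitz transport. -/
theorem DiscrepancyLE.bilipTransport [DecidableEq ι] [SFinite ν] [IsLocallyFiniteMeasure ν]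
    (h : DiscrepancyLE ν δ L e) (hL : 0 < L) (he : 0 ≤ e) (he1 : e ≤ 1 / 2)
    (he2 : 2 * Fintype.card ι * e ≤ 1 / 4) :
    BilipTransport ((1 + 8 * Fintype.card ι * e.toNNReal) ^ (2 * Fintype.card ι))
      (smoothDensity ν δ (fun _ => L) fun _ => L)
      (smoothDensity ν δ (fun _ => 2 * L) fun _ => 2 * L) := by
  set l : ℝ≥0 := (2 * Fintype.card ι * e / L).toNNReal with hl
  have hLl : L * l = 2 * Fintype.card ι * e := by
    rw [hl, Real.coe_toNNReal _ (by positivity)]; field_simp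
  have hK : 1 + 4 * L.toNNReal * l = 1 + 8 * Fintype.card ι * e.toNNReal := by
    rw [← NNReal.coe_inj]
    push_cast
    rw [Real.coe_toNNReal _ hL.le, Real.coe_toNNReal _ he, mul_assoc, hLl]
    ring
  rw [← hK, two_mul, pow_add]
  have hLL : ∀ _ : ι, L ≤ L := fun _ => le_rfl
  have hLL2 : ∀ _ : ι, L ≤ 2 * L := fun _ => by linarith
  refine BilipTransport.trans (g := smoothDensity ν δ (fun _ => 2 * L) fun _ => L) ?_ ?_
  · refine bilipTransport_double (Φ := fun m => smoothDensity ν δ m fun _ => L) hL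
      (hLl.trans_le he2) (fun m hm x => (h.abs_smoothDensity_sub_one_le hL hm hLL x).trans he1)
      (fun m hm => h.lipschitzWith_smoothDensity hL hm hLL) fun m hm i => ?_
    funext x
    exact boxMean_update_two_mul (fun i => hL.trans_le (hm i)) (h.integrableOn_boxDensity hL hLL m)
      i x
  · refine bilipTransport_double (Φ := fun m => smoothDensity ν δ (fun _ => 2 * L) m) hL
      (hLl.trans_le he2) (fun m hm x => (h.abs_smoothDensity_sub_one_le hL hLL2 hm x).trans he1)
      (fun m hm => h.lipschitzWith_smoothDensity hL hLL2 hm) fun m hm i => ?_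
    funext x
    simp only [smoothDensity]
    rw [boxDensity_update_two_mul fun i => hL.trans_le (hm i)]
    exact boxMean_half_add (h.integrableOn_boxDensity hL hm _) _ x

/-- If the discrepancies of `ν` at dyadic scales are summable, then the smoothed densities at
all large dyadic scales are related by uniformly bi-Lipschitz transports. -/
theorem exists_bilipTransport_smoothDensity [DecidableEq ι] [SFinite ν] [IsLocallyFiniteMeasure ν]
    {e : ℕ → ℝ} (hL : 0 < L) (hs : Summable e) (he : ∀ n, 0 ≤ e n)
    (h : ∀ n, DiscrepancyLE ν δ (2 ^ n * L) (e n)) :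
    ∃ (K : ℝ≥0) (n₀ : ℕ), e n₀ ≤ 1 / 2 ∧ ∀ n, n₀ ≤ n → BilipTransport K
      (smoothDensity ν δ (fun _ => 2 ^ n₀ * L) fun _ => 2 ^ n₀ * L)
      (smoothDensity ν δ (fun _ => 2 ^ n * L) fun _ => 2 ^ n * L) := by
  set d := Fintype.card ι
  have ht := hs.tendsto_atTop_zero
  have hev : ∀ᶠ n in atTop, e n ≤ 1 / 2 ∧ 2 * d * e n ≤ 1 / 4 := by
    refine (ht.eventually (eventually_le_nhds (by norm_num))).and ?_
    have := ht.const_mul (2 * d : ℝ)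
    rw [mul_zero] at this
    exact this.eventually (eventually_le_nhds (by norm_num))
  obtain ⟨n₀, hn₀⟩ := eventually_atTop.1 hev
  set F : ℕ → (ι → ℝ) → ℝ := fun n => smoothDensity ν δ (fun _ => 2 ^ n * L) fun _ => 2 ^ n * L
    with hF
  set k : ℕ → ℝ≥0 := fun n => (1 + 8 * d * (e n).toNNReal) ^ (2 * d) with hk
  have hstep : ∀ n, n₀ ≤ n → BilipTransport (k n) (F n) (F (n + 1)) := fun n hn => by
    have := (h n).bilipTransport (by positivity) (he n) (hn₀ n hn).1 (hn₀ n hn).2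
    simp only [hF, pow_succ' (2 : ℝ) n, mul_assoc (2 : ℝ) (2 ^ n)]
    exact this
  have hprod : ∀ n, n₀ ≤ n → BilipTransport (∏ j ∈ Finset.Ico n₀ n, k j) (F n₀) (F n) := by
    intro n hn
    induction n, hn using Nat.le_induction with
    | base => simpa using BilipTransport.refl (F n₀)
    | succ n hn ih =>
      rw [Finset.prod_Ico_succ_top hn, mul_comm]
      exact ih.trans (hstep n hn)
  refine ⟨(Real.exp (2 * d * (8 * d * ∑' n, e n))).toNNReal, n₀, (hn₀ n₀ le_rfl).1, fun n hn =>
    (hprod n hn).mono ?_⟩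
  rw [Real.le_toNNReal_iff_coe_le (Real.exp_pos _).le]
  push_cast
  have hkj : ∀ j, (k j : ℝ) ≤ Real.exp (2 * d * (8 * d * e j)) := fun j => by
    simp only [hk]
    push_cast
    have h2d : 2 * (d : ℝ) = (2 * d : ℕ) := by push_cast; rfl
    rw [Real.coe_toNNReal _ (he j), h2d, Real.exp_nat_mul]
    refine pow_le_pow_left₀ (by have := he j; positivity) ?_ _
    linarith [Real.add_one_le_exp (8 * d * e j)]
  refine (Finset.prod_le_prod (fun _ _ => NNReal.coe_nonneg _) fun j _ => hkj j).trans ?_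
  rw [← Real.exp_sum, ← Finset.mul_sum, ← Finset.mul_sum]
  gcongr
  exact hs.sum_le_tsum _ fun j _ => he j

end Smoothing

section Mass
variable {ι : Type*} [Fintype ι] {ν : Measure (ι → ℝ)} {δ L e : ℝ}

theorem lintegral_lintegral_measure_box (ν : Measure (ι → ℝ)) [SFinite ν] {l m : ι → ℝ}
    (hl : ∀ i, 0 ≤ l i) (hm : ∀ i, 0 ≤ m i) :
    ∫⁻ x, ∫⁻ y in box x l, ν (box y m) =
      ENNReal.ofReal (∏ i, l i) * (ENNReal.ofReal (∏ i, m i) * ν univ) := by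
  have h := lintegral_measure_box (volume.withDensity fun y => ν (box y m)) hl
  simp only [withDensity_apply _ (measurableSet_box _ _), withDensity_apply _ MeasurableSet.univ,
    Measure.restrict_univ, lintegral_measure_box ν hm] at h
  exact h

theorem DiscrepancyLE.ofReal_smoothDensity [SFinite ν] [IsLocallyFiniteMeasure ν]
    (h : DiscrepancyLE ν δ L e) (hL : 0 < L) (hδ : 0 < δ) {l m : ι → ℝ} (hl : ∀ i, L ≤ l i)
    (hm : ∀ i, L ≤ m i) (x : ι → ℝ) :
    ENNReal.ofReal (∏ i, l i) * (ENNReal.ofReal (∏ i, m i) * (ENNReal.ofReal δ *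
      ENNReal.ofReal (smoothDensity ν δ l m x))) = ∫⁻ y in box x l, ν (box y m) := by
  have hlp : 0 < ∏ i, l i := Finset.prod_pos fun i _ => hL.trans_le (hl i)
  have hmp : 0 < ∏ i, m i := Finset.prod_pos fun i _ => hL.trans_le (hm i)
  have hν : ∀ y, ν (box y m) = ENNReal.ofReal (δ * ∏ i, m i) *
      ENNReal.ofReal (boxDensity ν δ m y) := fun y => by
    rw [← ENNReal.ofReal_mul (by positivity), boxDensity, mul_div_cancel₀ _ (by positivity),
      ofReal_measureReal (measure_box_lt_top ν y m).ne]
  have hnn : 0 ≤ᵐ[volume.restrict (box x l)] boxDensity ν δ m :=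
    Eventually.of_forall fun y => div_nonneg measureReal_nonneg (by positivity)
  simp only [hν]
  rw [lintegral_const_mul _ (measurable_boxDensity m).ennreal_ofReal,
    ← ofReal_integral_eq_lintegral_ofReal (h.integrableOn_boxDensity hL hm l x) hnn,
    ← ENNReal.ofReal_mul hδ.le, ← ENNReal.ofReal_mul hmp.le, ← ENNReal.ofReal_mul hlp.le,
    ← ENNReal.ofReal_mul (by positivity), smoothDensity, boxMean]
  congr 1
  field_simp

/-- The measure with density `smoothDensity ν δ l m`, where all the sides are `L`. -/
noncomputable def smoothMeasure (ν : Measure (ι → ℝ)) (δ L : ℝ) : Measure (ι → ℝ) :=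
  volume.withDensity fun x => ENNReal.ofReal (smoothDensity ν δ (fun _ => L) (fun _ => L) x)

theorem dist_le_of_mem_box {x y p : ι → ℝ} (hL : 0 < L) (hy : y ∈ box x fun _ => L)
    (hp : p ∈ box y fun _ => L) : dist x p ≤ 2 * L := by
  refine (dist_pi_le_iff (by positivity)).2 fun i => ?_
  have h1 := mem_box.1 hy i
  have h2 := mem_box.1 hp i
  rw [Real.dist_eq, abs_le]
  constructor <;> linarith

theorem DiscrepancyLE.setLIntegral_box [SFinite ν] [IsLocallyFiniteMeasure ν]
    (h : DiscrepancyLE ν δ L e) (hL : 0 < L) (hδ : 0 < δ) {S : Set (ι → ℝ)}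
    (hS : MeasurableSet S) :
    ∫⁻ x in S, ∫⁻ y in box x fun _ => L, ν (box y fun _ => L) =
      ENNReal.ofReal (∏ _i : ι, L) * (ENNReal.ofReal (∏ _i : ι, L) *
        (ENNReal.ofReal δ * smoothMeasure ν δ L S)) := by
  have hLL : ∀ _ : ι, L ≤ L := fun _ => le_rfl
  simp only [← h.ofReal_smoothDensity hL hδ hLL hLL]
  rw [lintegral_const_mul' _ _ ENNReal.ofReal_ne_top,
    lintegral_const_mul' _ _ ENNReal.ofReal_ne_top,
    lintegral_const_mul' _ _ ENNReal.ofReal_ne_top, smoothMeasure, withDensity_apply _ hS]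

theorem ofReal_prod_mul_le_iff (hL : 0 < L) {a b : ℝ≥0∞} :
    ENNReal.ofReal (∏ _i : ι, L) * (ENNReal.ofReal (∏ _i : ι, L) * a) ≤
      ENNReal.ofReal (∏ _i : ι, L) * (ENNReal.ofReal (∏ _i : ι, L) * b) ↔ a ≤ b := by
  have hp : 0 < ∏ _i : ι, L := Finset.prod_pos fun i _ => hL
  have h0 := (ENNReal.ofReal_pos.2 hp).ne'
  rw [ENNReal.mul_le_mul_iff_right h0 ENNReal.ofReal_ne_top,
    ENNReal.mul_le_mul_iff_right h0 ENNReal.ofReal_ne_top]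

theorem DiscrepancyLE.measure_le_smoothMeasure [SFinite ν] [IsLocallyFiniteMeasure ν]
    (h : DiscrepancyLE ν δ L e) (hL : 0 < L) (hδ : 0 < δ) {A S : Set (ι → ℝ)}
    (hS : MeasurableSet S) (hAS : ∀ p ∈ A, ∀ x, dist x p ≤ 2 * L → x ∈ S) :
    ν A ≤ ENNReal.ofReal δ * smoothMeasure ν δ L S := by
  rw [← ofReal_prod_mul_le_iff (ι := ι) hL, ← h.setLIntegral_box hL hδ hS,
    ← Measure.restrict_apply_univ A,
    ← lintegral_lintegral_measure_box (ν.restrict A) (fun _ => hL.le) (fun _ => hL.le),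
    ← lintegral_indicator hS]
  refine lintegral_mono fun x => ?_
  by_cases hx : x ∈ S
  · rw [indicator_of_mem hx]
    exact lintegral_mono fun y => Measure.restrict_apply_le _ _
  · rw [indicator_of_notMem hx, nonpos_iff_eq_zero]
    rw [setLIntegral_congr_fun (g := fun _ => 0) (measurableSet_box _ _), lintegral_zero]
    intro y hy
    simp only
    rw [Measure.restrict_apply (measurableSet_box _ _)]
    convert measure_empty (μ := ν)
    refine eq_empty_of_forall_notMem fun p hp => hx (hAS p hp.2 x (dist_le_of_mem_box hL hy hp.1))

theorem DiscrepancyLE.smoothMeasure_le_measure [SFinite ν] [IsLocallyFiniteMeasure ν]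
    (h : DiscrepancyLE ν δ L e) (hL : 0 < L) (hδ : 0 < δ) {E S : Set (ι → ℝ)}
    (hE : MeasurableSet E) (hES : ∀ x ∈ E, ∀ p, dist x p ≤ 2 * L → p ∈ S) :
    ENNReal.ofReal δ * smoothMeasure ν δ L E ≤ ν S := by
  rw [← ofReal_prod_mul_le_iff (ι := ι) hL, ← h.setLIntegral_box hL hδ hE,
    ← Measure.restrict_apply_univ S,
    ← lintegral_lintegral_measure_box (ν.restrict S) (fun _ => hL.le) (fun _ => hL.le),
    ← lintegral_indicator hE]
  refine lintegral_mono fun x => ?_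
  by_cases hx : x ∈ E
  · rw [indicator_of_mem hx]
    refine setLIntegral_mono_ae' (measurableSet_box _ _) (Eventually.of_forall fun y hy => ?_)
    rw [Measure.restrict_apply (measurableSet_box _ _), inter_eq_left.2]
    exact fun p hp => hES x hx p (dist_le_of_mem_box hL hy hp)
  · rw [indicator_of_notMem hx]; exact zero_le

end Mass

theorem le_withDensity_of_abs_sub_one_le {X : Type*} [MeasurableSpace X] {μ : Measure X}
    {g : X → ℝ} {e : ℝ} (hg : ∀ x, |g x - 1| ≤ e) {E : Set X} (hE : MeasurableSet E) :
    ENNReal.ofReal (1 - e) * μ E ≤ μ.withDensity (fun x => ENNReal.ofReal (g x)) E := by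
  rw [withDensity_apply _ hE, ← setLIntegral_const]
  exact lintegral_mono fun x => ENNReal.ofReal_le_ofReal (by linarith [(abs_le.1 (hg x)).1])

theorem withDensity_le_of_abs_sub_one_le {X : Type*} [MeasurableSpace X] {μ : Measure X}
    {g : X → ℝ} {e : ℝ} (hg : ∀ x, |g x - 1| ≤ e) {E : Set X} (hE : MeasurableSet E) :
    μ.withDensity (fun x => ENNReal.ofReal (g x)) E ≤ ENNReal.ofReal (1 + e) * μ E := by
  rw [withDensity_apply _ hE, ← setLIntegral_const]
  exact lintegral_mono fun x => ENNReal.ofReal_le_ofReal (by linarith [(abs_le.1 (hg x)).2])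

/-- `G` is a bi-Lipschitz bijection fixing `0` whose push-forward of `μ` has density `e`-close
to `1`. -/
structure NearlyUniformizes {ι : Type*} [Fintype ι] (μ : Measure (ι → ℝ)) (K : ℝ≥0) (e : ℝ)
    (G : (ι → ℝ) → ι → ℝ) : Prop where
  lipschitz : LipschitzWith K G
  antilipschitz : AntilipschitzWith K G
  map_zero : G 0 = 0
  le_measure : ∀ E, MeasurableSet E → ENNReal.ofReal (1 - e) * volume E ≤ μ (G ⁻¹' E)
  measure_le : ∀ E, MeasurableSet E → μ (G ⁻¹' E) ≤ ENNReal.ofReal (1 + e) * volume E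

theorem BilipTransport.exists_nearlyUniformizes {ι : Type*} [Fintype ι] {K : ℝ≥0}
    {f g : (ι → ℝ) → ℝ} (h : BilipTransport K f g) {e : ℝ} (hg : ∀ x, |g x - 1| ≤ e) :
    ∃ G, NearlyUniformizes (volume.withDensity fun x => ENNReal.ofReal (f x)) K e G := by
  obtain ⟨H, h1, h2, h3⟩ := h
  have hpre : ∀ E : Set (ι → ℝ), MeasurableSet E →
      (volume.withDensity fun x => ENNReal.ofReal (f x)) ((fun x => H x - H 0) ⁻¹' E) =
        (volume.withDensity fun x => ENNReal.ofReal (g x)) ((fun y => y - H 0) ⁻¹' E) :=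
    fun E hE => by
      rw [← h3, Measure.map_apply H.continuous.measurable ((measurable_sub_const _) hE)]
      rfl
  have hvol : ∀ E : Set (ι → ℝ), volume ((fun y => y - H 0) ⁻¹' E) = volume E := fun E => by
    simp only [sub_eq_add_neg]
    exact measure_preimage_add_right _ _ _
  refine ⟨fun x => H x - H 0, ?_, ?_, sub_self _, fun E hE => ?_, fun E hE => ?_⟩
  · intro x y; simpa using h1 x y
  · intro x y; simpa using h2 x y
  · rw [hpre E hE, ← hvol E]
    exact le_withDensity_of_abs_sub_one_le hg ((measurable_sub_const _) hE)
  · rw [hpre E hE, ← hvol E]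
    exact withDensity_le_of_abs_sub_one_le hg ((measurable_sub_const _) hE)

/-- Uniformly bi-Lipschitz maps fixing a point converge pointwise along an ultrafilter. -/
theorem exists_ultralimit {X Y α : Type*} [PseudoMetricSpace X] [PseudoMetricSpace Y]
    [ProperSpace Y] (U : Ultrafilter α) {K : ℝ≥0} {G : α → X → Y} (hG : ∀ n, LipschitzWith K (G n))
    (hG' : ∀ n, AntilipschitzWith K (G n)) {x₀ : X} {y₀ : Y} (h0 : ∀ n, G n x₀ = y₀) :
    ∃ H : X → Y, LipschitzWith K H ∧ AntilipschitzWith K H ∧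
      ∀ x, Tendsto (fun n => G n x) U (𝓝 (H x)) := by
  have hlim : ∀ x, ∃ y, Tendsto (fun n => G n x) U (𝓝 y) := fun x => by
    obtain ⟨y, -, hy⟩ := (isCompact_closedBall y₀ (K * dist x x₀)).ultrafilter_le_nhds
      (U.map fun n => G n x) (by
        rw [le_principal_iff]
        refine Filter.mem_map.2 (Eventually.of_forall fun n => ?_)
        have := (hG n).dist_le_mul x x₀
        rw [h0] at this
        exact this)
    exact ⟨y, hy⟩
  choose H hH using hlim
  refine ⟨H, LipschitzWith.of_dist_le_mul fun x y => ?_,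
    AntilipschitzWith.of_le_mul_dist fun x y => ?_, hH⟩
  · exact le_of_tendsto ((hH x).dist (hH y)) (Eventually.of_forall fun n => (hG n).dist_le_mul x y)
  · exact ge_of_tendsto (((hH x).dist (hH y)).const_mul _)
      (Eventually.of_forall fun n => (hG' n).le_mul_dist x y)

/-- The point of the lattice `a * ℤ ^ ι` with coordinates `z`. -/
def latticePoint {ι : Type*} (a : ℝ) (z : ι → ℤ) : ι → ℝ := fun i => a * z i

theorem exists_mem_box_latticePoint {ι : Type*} {a : ℝ} (ha : 0 < a) (y : ι → ℝ) :
    ∃ z : ι → ℤ, y ∈ box (latticePoint a z) fun _ => a := by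
  refine ⟨fun i => ⌊y i / a⌋, mem_box.2 fun i => ?_⟩
  have h1 := Int.floor_le (y i / a)
  have h2 := Int.lt_floor_add_one (y i / a)
  rw [le_div_iff₀ ha] at h1
  rw [div_lt_iff₀ ha] at h2
  simp only [latticePoint]
  constructor <;> linarith

theorem pairwise_disjoint_box_latticePoint {ι : Type*} {a : ℝ} (ha : 0 < a) :
    Pairwise (Function.onFun Disjoint fun z : ι → ℤ => box (latticePoint a z) fun _ => a) := by
  intro z w hzw
  refine Set.disjoint_left.2 fun x hx hx' => hzw (funext fun i => ?_)
  have h1 := mem_box.1 hx i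
  have h2 := mem_box.1 hx' i
  simp only [latticePoint] at h1 h2
  have h3 : a * (z i : ℝ) < a * (w i + 1) := by linarith
  have h4 : a * (w i : ℝ) < a * (z i + 1) := by linarith
  have h5 := lt_of_mul_lt_mul_left h3 ha.le
  have h6 := lt_of_mul_lt_mul_left h4 ha.le
  norm_cast at h5 h6
  omega

section Lattice
variable {ι : Type*} [Fintype ι]

theorem dist_le_of_mem_box_latticePoint {a : ℝ} (ha : 0 < a) {x y : ι → ℝ}
    (hy : y ∈ box x fun _ => a) : dist y x ≤ a := by
  refine (dist_pi_le_iff ha.le).2 fun i => ?_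
  have h1 := mem_box.1 hy i
  rw [Real.dist_eq, abs_le]
  constructor <;> linarith

/-- The union of the cells of the lattice `a * ℤ ^ ι` at the points of `B`. -/
def latticeCells (a : ℝ) (B : Finset (ι → ℤ)) : Set (ι → ℝ) :=
  ⋃ z ∈ B, box (latticePoint a z) fun _ => a

theorem measurableSet_latticeCells (a : ℝ) (B : Finset (ι → ℤ)) :
    MeasurableSet (latticeCells a B) :=
  B.measurableSet_biUnion fun _ _ => measurableSet_box _ _

theorem volume_latticeCells {a : ℝ} (ha : 0 < a) (B : Finset (ι → ℤ)) :
    volume (latticeCells a B) = B.card * ENNReal.ofReal (a ^ Fintype.card ι) := by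
  rw [latticeCells, measure_biUnion_finset
    (fun z _ w _ hzw => pairwise_disjoint_box_latticePoint ha hzw) fun z _ => measurableSet_box _ _]
  simp [volume_box fun _ => ha.le]

theorem finite_setOf_dist_latticePoint_le {a : ℝ} (ha : 0 < a) (x : ι → ℝ) (c : ℝ) :
    {z : ι → ℤ | dist x (latticePoint a z) ≤ c}.Finite := by
  classical
  refine (Set.finite_Icc (fun i => ⌊(x i - c) / a⌋) fun i => ⌈(x i + c) / a⌉).subset fun z hz => ?_
  have h : ∀ i, |x i - a * z i| ≤ c := fun i => by
    have := (dist_le_pi_dist x (latticePoint a z) i).trans hz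
    rwa [Real.dist_eq] at this
  constructor <;> intro i
  · have : (x i - c) / a ≤ z i := by
      rw [div_le_iff₀ ha]; linarith [(abs_le.1 (h i)).2]
    exact_mod_cast (Int.floor_le _).trans this
  · have : (z i : ℝ) ≤ (x i + c) / a := by
      rw [le_div_iff₀ ha]; linarith [(abs_le.1 (h i)).1]
    exact_mod_cast this.trans (Int.le_ceil _)

end Lattice

/-- A symmetric form of Hall's marriage theorem for locally finite relations. -/
theorem exists_bijective_of_hall {α β : Type*} (R : α → β → Prop)
    (h₁ : ∀ x, {y | R x y}.Finite) (h₂ : ∀ y, {x | R x y}.Finite)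
    (hA : ∀ A : Finset α, (A.card : ℕ∞) ≤ {y | ∃ x ∈ A, R x y}.encard)
    (hB : ∀ B : Finset β, (B.card : ℕ∞) ≤ {x | ∃ y ∈ B, R x y}.encard) :
    ∃ f : α → β, Function.Bijective f ∧ ∀ x, R x (f x) := by
  classical
  obtain ⟨f, hf, hf'⟩ := (Finset.all_card_le_biUnion_card_iff_exists_injective
    fun x => (h₁ x).toFinset).1 fun A => by
      have := hA A
      have he : {y | ∃ x ∈ A, R x y} = (A.biUnion fun x => (h₁ x).toFinset : Finset β) := by
        ext; simp
      rw [he, Set.encard_coe_eq_coe_finsetCard] at this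
      exact_mod_cast this
  obtain ⟨g, hg, hg'⟩ := (Finset.all_card_le_biUnion_card_iff_exists_injective
    fun y => (h₂ y).toFinset).1 fun B => by
      have := hB B
      have he : {x | ∃ y ∈ B, R x y} = (B.biUnion fun y => (h₂ y).toFinset : Finset α) := by
        ext; simp
      rw [he, Set.encard_coe_eq_coe_finsetCard] at this
      exact_mod_cast this
  exact Function.Embedding.schroeder_bernstein_of_rel hf hg R (fun x => by simpa using hf' x)
    fun y => by simpa using hg' y

section Matching
variable {ι α : Type*} [Fintype ι] {D : Set (ι → ℝ)} {δ L ε a : ℝ} {K : ℝ≥0} {U : Ultrafilter α}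
  {e : α → ℝ} {G : α → (ι → ℝ) → ι → ℝ} {H : (ι → ℝ) → ι → ℝ}

theorem card_le_encard_lattice (hD : MeasurableSet D)
    [IsLocallyFiniteMeasure (Measure.count.restrict D)]
    (h : DiscrepancyLE (Measure.count.restrict D) δ L ε) (hL : 0 < L) (hδ : 0 < δ) (ha : 0 < a)
    (haδ : δ * a ^ Fintype.card ι = 1)
    (hG : ∀ n, NearlyUniformizes (smoothMeasure (Measure.count.restrict D) δ L) K (e n) (G n))
    (he : Tendsto e U (𝓝 0)) (hH : ∀ x, Tendsto (fun n => G n x) U (𝓝 (H x))) (A : Finset D) :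
    (A.card : ℕ∞) ≤
      {z | ∃ p ∈ A, dist (H p) (latticePoint a z) ≤ K * (2 * L) + 1 + a}.encard := by
  set c := K * (2 * L) + 1 + a with hc
  have hfin : {z | ∃ p ∈ A, dist (H p) (latticePoint a z) ≤ c}.Finite := by
    have := A.finite_toSet.biUnion fun p _ => finite_setOf_dist_latticePoint_le ha (H p) c
    refine this.subset ?_
    rintro z ⟨p, hp, hz⟩
    exact mem_biUnion hp hz
  obtain ⟨Z, hZ⟩ := hfin.exists_finset_coe
  rw [← hZ, Set.encard_coe_eq_coe_finsetCard]
  suffices (A.card : ℝ) ≤ Z.card by exact_mod_cast this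
  have hlim : Tendsto (fun n => (1 + e n) * Z.card) U (𝓝 Z.card) := by
    simpa using (he.const_add 1).mul_const (Z.card : ℝ)
  refine ge_of_tendsto hlim ?_
  have hev1 : ∀ᶠ n in U, ∀ p ∈ A, dist (G n p) (H p) ≤ 1 := by
    rw [Filter.eventually_all_finset]
    intro p _
    exact ((tendsto_iff_dist_tendsto_zero.1 (hH p)).eventually (eventually_le_nhds zero_lt_one))
  have hev2 : ∀ᶠ n in U, -1 ≤ e n := he.eventually (eventually_ge_nhds (by norm_num))
  filter_upwards [hev1, hev2] with n hn hn'
  set S : Set (ι → ℝ) := ⋃ p ∈ A, Metric.closedBall (p : ι → ℝ) (2 * L) with hS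
  have hSm : MeasurableSet S := A.measurableSet_biUnion fun p _ => measurableSet_closedBall
  have h1 := h.measure_le_smoothMeasure (A := Subtype.val '' (A : Set D)) hL hδ hSm (by
    rintro _ ⟨p, hp, rfl⟩ x hx
    exact mem_biUnion hp (Metric.mem_closedBall.2 hx))
  have h2 : (Measure.count.restrict D) (Subtype.val '' (A : Set D)) = A.card := by
    rw [Measure.restrict_apply' hD, inter_eq_left.2 (Subtype.coe_image_subset _ _),
      Measure.count_apply (A.finite_toSet.image _).measurableSet,
      Subtype.val_injective.injOn.encard_image, Set.encard_coe_eq_coe_finsetCard]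
    simp
  have h3 : S ⊆ G n ⁻¹' latticeCells a Z := by
    intro x hx
    obtain ⟨p, hp, hxp⟩ := mem_iUnion₂.1 hx
    obtain ⟨z, hz⟩ := exists_mem_box_latticePoint ha (G n x)
    refine mem_iUnion₂.2 ⟨z, ?_, hz⟩
    rw [← Finset.mem_coe, hZ]
    refine ⟨p, hp, ?_⟩
    have d1 := (hG n).lipschitz.dist_le_mul x p
    have d2 := dist_le_of_mem_box_latticePoint ha hz
    have d3 := hn p hp
    have d4 : K * dist x (p : ι → ℝ) ≤ K * (2 * L) :=
      mul_le_mul_of_nonneg_left (Metric.mem_closedBall.1 hxp) K.2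
    have d5 := dist_triangle4 (H p) (G n p) (G n x) (latticePoint a z)
    rw [dist_comm (H p) (G n p), dist_comm (G n p) (G n x)] at d5
    rw [hc]; linarith
  have h4 := (measure_mono h3).trans ((hG n).measure_le _ (measurableSet_latticeCells a Z))
  rw [volume_latticeCells ha] at h4
  have h5 := h1.trans (mul_le_mul_right h4 (ENNReal.ofReal δ))
  rw [h2, ← ENNReal.ofReal_natCast, ← ENNReal.ofReal_natCast,
    ← ENNReal.ofReal_mul (by positivity), ← ENNReal.ofReal_mul (by linarith),
    ← ENNReal.ofReal_mul hδ.le] at h5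
  have h6 : δ * ((1 + e n) * (Z.card * a ^ Fintype.card ι)) = (1 + e n) * Z.card := by
    rw [← mul_one ((1 + e n) * (Z.card : ℝ)), ← haδ]; ring
  rw [h6] at h5
  exact (ENNReal.ofReal_le_ofReal_iff (mul_nonneg (by linarith) (Nat.cast_nonneg _))).1 h5

theorem finite_inter_closedBall (hD : MeasurableSet D)
    [IsLocallyFiniteMeasure (Measure.count.restrict D)] (x : ι → ℝ) (M : ℝ) :
    (D ∩ Metric.closedBall x M).Finite := by
  have h1 := (isCompact_closedBall x M).measure_lt_top (μ := Measure.count.restrict D)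
  rw [Measure.restrict_apply' hD, inter_comm] at h1
  exact (Measure.count_apply_lt_top' (hD.inter measurableSet_closedBall)).1 h1

theorem card_le_encard_of_lattice (hD : MeasurableSet D)
    [IsLocallyFiniteMeasure (Measure.count.restrict D)]
    (h : DiscrepancyLE (Measure.count.restrict D) δ L ε) (hL : 0 < L) (hδ : 0 < δ) (ha : 0 < a)
    (haδ : δ * a ^ Fintype.card ι = 1)
    (hG : ∀ n, NearlyUniformizes (smoothMeasure (Measure.count.restrict D) δ L) K (e n) (G n))
    (he : Tendsto e U (𝓝 0)) (hH : ∀ x, Tendsto (fun n => G n x) U (𝓝 (H x)))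
    (B : Finset (ι → ℤ)) :
    (B.card : ℕ∞) ≤
      {p : D | ∃ z ∈ B, dist (H p) (latticePoint a z) ≤ K * (2 * L) + 1 + a}.encard := by
  set c := K * (2 * L) + 1 + a with hc
  set P := {p : D | ∃ z ∈ B, dist (H p) (latticePoint a z) ≤ c} with hP
  by_cases hPf : P.Finite
  swap
  · rw [Set.encard_eq_top_iff.2 hPf]; exact le_top
  obtain ⟨P', hP'⟩ := hPf.exists_finset_coe
  rw [← hP', Set.encard_coe_eq_coe_finsetCard]
  suffices (B.card : ℝ) ≤ P'.card by exact_mod_cast this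
  have hlim : Tendsto (fun n => (1 - e n) * B.card) U (𝓝 B.card) := by
    simpa using (he.const_sub 1).mul_const (B.card : ℝ)
  refine le_of_tendsto hlim ?_
  obtain ⟨N, hN⟩ : ∃ N, ∀ z ∈ B, dist (latticePoint a z) 0 ≤ N :=
    let ⟨N, hN⟩ := (B.finite_toSet.image fun z => dist (latticePoint a z) 0).bddAbove
    ⟨N, fun z hz => hN ⟨z, hz, rfl⟩⟩
  have hQ := finite_inter_closedBall hD 0 (K * (N + c))
  have hev1 : ∀ᶠ n in U, ∀ p ∈ D ∩ Metric.closedBall 0 (K * (N + c)), dist (G n p) (H p) ≤ 1 := by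
    rw [Filter.eventually_all_finite hQ]
    intro p _
    exact ((tendsto_iff_dist_tendsto_zero.1 (hH p)).eventually (eventually_le_nhds zero_lt_one))
  filter_upwards [hev1] with n hn
  have h1 := h.smoothMeasure_le_measure (E := G n ⁻¹' latticeCells a B)
    (S := {p | ∃ x ∈ G n ⁻¹' latticeCells a B, dist x p ≤ 2 * L}) hL hδ
    ((hG n).lipschitz.continuous.measurable (measurableSet_latticeCells a B))
    fun x hx p hp => ⟨x, hx, hp⟩
  have h3 : {p | ∃ x ∈ G n ⁻¹' latticeCells a B, dist x p ≤ 2 * L} ∩ D ⊆ Subtype.val '' P := by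
    rintro p ⟨⟨x, hx, hxp⟩, hpD⟩
    obtain ⟨z, hz, hxz⟩ := mem_iUnion₂.1 hx
    have d1 := (hG n).lipschitz.dist_le_mul x p
    have d2 := dist_le_of_mem_box_latticePoint ha hxz
    have d4 : K * dist x p ≤ K * (2 * L) := mul_le_mul_of_nonneg_left hxp K.2
    have d5 := dist_triangle_left (G n p) (latticePoint a z) (G n x)
    have d6 := dist_triangle (G n p) (latticePoint a z) 0
    have d7 := (hG n).antilipschitz.le_mul_dist p 0
    have d8 := hN z hz
    rw [(hG n).map_zero] at d7
    have d9 := hn p ⟨hpD, Metric.mem_closedBall.2 (d7.trans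
      (mul_le_mul_of_nonneg_left (by rw [hc]; linarith) K.2))⟩
    have d10 := dist_triangle_left (H p) (latticePoint a z) (G n p)
    exact ⟨⟨p, hpD⟩, ⟨z, hz, by rw [hc]; simp only; linarith⟩, rfl⟩
  have h4 := mul_le_mul_right ((hG n).le_measure _ (measurableSet_latticeCells a B))
    (ENNReal.ofReal δ)
  rw [volume_latticeCells ha] at h4
  have h5 : (Measure.count.restrict D)
      {p | ∃ x ∈ G n ⁻¹' latticeCells a B, dist x p ≤ 2 * L} ≤ P'.card := by
    rw [Measure.restrict_apply' hD]
    refine (measure_mono h3).trans (le_of_eq ?_)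
    rw [← hP', Measure.count_apply (P'.finite_toSet.image _).measurableSet,
      Subtype.val_injective.injOn.encard_image, Set.encard_coe_eq_coe_finsetCard]
    simp
  have h6 := (h4.trans h1).trans h5
  rw [← ENNReal.ofReal_natCast, ← ENNReal.ofReal_natCast,
    ← ENNReal.ofReal_mul (by positivity)] at h6
  by_cases he1 : 0 ≤ 1 - e n
  · rw [← ENNReal.ofReal_mul he1, ← ENNReal.ofReal_mul hδ.le] at h6
    have h7 : δ * ((1 - e n) * (B.card * a ^ Fintype.card ι)) = (1 - e n) * B.card := by
      rw [← mul_one ((1 - e n) * (B.card : ℝ)), ← haδ]; ring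
    rw [h7] at h6
    exact (ENNReal.ofReal_le_ofReal_iff (Nat.cast_nonneg _)).1 h6
  · exact (mul_nonpos_of_nonpos_of_nonneg (not_le.1 he1).le (Nat.cast_nonneg _)).trans
      (Nat.cast_nonneg _)

end Matching

section Rectifiable
variable {ι : Type*} [Fintype ι] {D : Set (ι → ℝ)}

theorem isLocallyFiniteMeasure_count_restrict (hD : MeasurableSet D) {r : ℝ} (hr : 0 < r)
    (hsep : D.Pairwise fun x y => r ≤ dist x y) :
    IsLocallyFiniteMeasure (Measure.count.restrict D) := by
  refine ⟨fun x => ⟨Metric.ball x (r / 2), Metric.ball_mem_nhds x (by positivity), ?_⟩⟩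
  rw [Measure.restrict_apply' hD]
  refine Measure.count_apply_lt_top.2 (Set.Subsingleton.finite fun y hy z hz => ?_)
  by_contra hyz
  have h1 := hsep hy.2 hz.2 hyz
  have h2 := dist_triangle_right y z x
  have h3 := Metric.mem_ball.1 hy.1
  have h4 := Metric.mem_ball.1 hz.1
  linarith

/-- A measure whose discrepancies at dyadic scales are summable, and which counts the points of
`D`, gives a bijection from `D` to a lattice at bounded distance from a bi-Lipschitz map. -/
theorem exists_bijective_lattice [Nonempty ι] (hD : MeasurableSet D)
    [IsLocallyFiniteMeasure (Measure.count.restrict D)] {δ L : ℝ} {e : ℕ → ℝ} (hδ : 0 < δ)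
    (hL : 0 < L) (hs : Summable e) (he : ∀ n, 0 ≤ e n)
    (h : ∀ n, DiscrepancyLE (Measure.count.restrict D) δ (2 ^ n * L) (e n)) :
    ∃ (K : ℝ≥0) (a c : ℝ) (H : (ι → ℝ) → ι → ℝ), 0 < a ∧ 0 ≤ c ∧ LipschitzWith K H ∧
      AntilipschitzWith K H ∧ ∃ f : D → ι → ℤ, Function.Bijective f ∧
        ∀ p : D, dist (H p) (latticePoint a (f p)) ≤ c := by
  classical
  obtain ⟨K, n₀, -, hK⟩ := exists_bilipTransport_smoothDensity hL hs he h
  set L' : ℝ := 2 ^ n₀ * L with hL'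
  have hL'0 : 0 < L' := by positivity
  have hG : ∀ n, ∃ G, NearlyUniformizes (smoothMeasure (Measure.count.restrict D) δ L') K
      (e (n + n₀)) G := fun n =>
    (hK (n + n₀) (Nat.le_add_left _ _)).exists_nearlyUniformizes
      ((h (n + n₀)).abs_smoothDensity_sub_one_le (by positivity) (fun _ => le_rfl) fun _ => le_rfl)
  choose G hG using hG
  obtain ⟨H, hH1, hH2, hH⟩ := exists_ultralimit (hyperfilter ℕ) (fun n => (hG n).lipschitz)
    (fun n => (hG n).antilipschitz) fun n => (hG n).map_zero
  have het : Tendsto (fun n => e (n + n₀)) (hyperfilter ℕ : Filter ℕ) (𝓝 0) :=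
    ((tendsto_add_atTop_iff_nat n₀).2 hs.tendsto_atTop_zero).mono_left
      (hyperfilter_le_cofinite.trans_eq Nat.cofinite_eq_atTop)
  have hcard : (Fintype.card ι : ℝ) ≠ 0 := Nat.cast_ne_zero.2 Fintype.card_ne_zero
  set a : ℝ := (δ⁻¹) ^ ((Fintype.card ι : ℝ)⁻¹) with ha
  have ha0 : 0 < a := by positivity
  have haδ : δ * a ^ Fintype.card ι = 1 := by
    rw [ha, Real.rpow_inv_natCast_pow (by positivity) Fintype.card_ne_zero]
    exact mul_inv_cancel₀ hδ.ne'
  set c : ℝ := K * (2 * L') + 1 + a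
  refine ⟨K, a, c, H, ha0, by positivity, hH1, hH2,
    exists_bijective_of_hall (fun (p : D) z => dist (H p) (latticePoint a z) ≤ c)
      (fun p => finite_setOf_dist_latticePoint_le ha0 _ _) (fun z => ?_)
      (card_le_encard_lattice hD (h n₀) hL'0 hδ ha0 haδ hG het hH)
      (card_le_encard_of_lattice hD (h n₀) hL'0 hδ ha0 haδ hG het hH)⟩
  have hfin := finite_inter_closedBall hD 0 (K * (c + dist (latticePoint a z) (H 0)))
  refine Set.Finite.of_finite_image (hfin.subset ?_) Subtype.val_injective.injOn
  rintro _ ⟨p, hp, rfl⟩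
  refine ⟨p.2, Metric.mem_closedBall.2 ((hH2.le_mul_dist p 0).trans ?_)⟩
  refine mul_le_mul_of_nonneg_left ((dist_triangle _ (latticePoint a z) _).trans ?_) K.2
  exact add_le_add_left hp _

theorem dist_latticePoint {a : ℝ} (ha : 0 ≤ a) (z w : ι → ℤ) :
    dist (latticePoint a z) (latticePoint a w) = a * dist z w := by
  have : latticePoint a z = a • fun i => (z i : ℝ) := rfl
  rw [this]
  have : latticePoint a w = a • fun i => (w i : ℝ) := rfl
  rw [this, dist_smul₀, Real.norm_of_nonneg ha]
  rfl

theorem one_le_dist_of_ne {z w : ι → ℤ} (h : z ≠ w) : 1 ≤ dist z w := by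
  obtain ⟨i, hi⟩ := Function.ne_iff.1 h
  exact (Int.pairwise_one_le_dist hi).trans (dist_le_pi_dist z w i)

/-- A bijection onto a lattice at bounded distance from a bi-Lipschitz map is bi-Lipschitz on a
uniformly discrete set. -/
theorem bilipschitz_of_dist_le {r : ℝ} (hr : 0 < r)
    (hsep : D.Pairwise fun x y => r ≤ dist x y) {K : ℝ≥0} {a c : ℝ} {H : (ι → ℝ) → ι → ℝ}
    (ha : 0 < a) (hc : 0 ≤ c) (hH : LipschitzWith K H) (hH' : AntilipschitzWith K H)
    {f : D → ι → ℤ} (hf : Function.Injective f)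
    (hfH : ∀ p : D, dist (H p) (latticePoint a (f p)) ≤ c) :
    ∃ K' : ℝ, 1 ≤ K' ∧ ∀ u v : D, dist u v ≤ K' * dist (f u) (f v) ∧
      dist (f u) (f v) ≤ K' * dist u v := by
  have h1 : 0 ≤ (2 * c / r + K) / a := by positivity
  have h2 : 0 ≤ K * (2 * c + a) := by positivity
  refine ⟨1 + (2 * c / r + K) / a + K * (2 * c + a), by linarith, fun u v => ?_⟩
  by_cases huv : u = v
  · subst huv; simp
  have huv' : r ≤ dist u v := hsep u.2 v.2 (Subtype.coe_injective.ne huv)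
  have hf1 : 1 ≤ dist (f u) (f v) := one_le_dist_of_ne (hf.ne huv)
  have hup := hH.dist_le_mul u v
  have hlo := hH'.le_mul_dist u v
  have e1 := dist_latticePoint ha.le (f u) (f v)
  have e2 := dist_triangle4 (H u) (latticePoint a (f u)) (latticePoint a (f v)) (H v)
  have e3 := dist_triangle4 (latticePoint a (f u)) (H u) (H v) (latticePoint a (f v))
  rw [dist_comm (latticePoint a (f v)) (H v), e1] at e2
  rw [dist_comm (latticePoint a (f u)) (H u), e1] at e3
  have hu := hfH u
  have hv := hfH v
  rw [Subtype.dist_eq] at huv' ⊢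
  constructor
  · have : dist (H u) (H v) ≤ (2 * c + a) * dist (f u) (f v) := by nlinarith
    calc dist (u : ι → ℝ) v ≤ K * ((2 * c + a) * dist (f u) (f v)) :=
          hlo.trans (mul_le_mul_of_nonneg_left this K.2)
      _ = K * (2 * c + a) * dist (f u) (f v) := by ring
      _ ≤ _ := mul_le_mul_of_nonneg_right (by linarith) (by linarith)
  · have : dist (f u) (f v) ≤ (2 * c / r + K) / a * dist (u : ι → ℝ) v := by
      rw [div_mul_eq_mul_div, le_div_iff₀ ha]
      have : 2 * c ≤ 2 * c / r * dist (u : ι → ℝ) v := by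
        rw [div_mul_eq_mul_div, le_div_iff₀ hr]
        exact mul_le_mul_of_nonneg_left huv' (by positivity)
      linarith
    exact this.trans (mul_le_mul_of_nonneg_right (by linarith) (by linarith))

theorem densityBounds_count [DecidableEq ι] (hD : MeasurableSet D)
    [IsLocallyFiniteMeasure (Measure.count.restrict D)] {r R L : ℝ} (hr : 0 < r)
    (hsep : D.Pairwise fun x y => r ≤ dist x y) (hdense : ∀ x, ∃ y ∈ D, dist x y ≤ R)
    (hL : 0 < L) (hLr : r / 4 ≤ L) (hLR : 2 * R < L) :
    DensityBounds (fun a l => (Measure.count.restrict D).real (box a l)) L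
      ((2 * L)⁻¹ ^ Fintype.card ι) ((r / 4)⁻¹ ^ Fintype.card ι) := by
  intro a l hl
  have hadd := boxAdditive_measure (Measure.count.restrict D)
  have hfin := fun a l => (measure_box_lt_top (Measure.count.restrict D) a l).ne
  have hpow : ∀ c : ℝ, ∀ l : ι → ℝ, c ^ Fintype.card ι * ∏ i, l i = ∏ i, c * l i := fun c l => by
    rw [Finset.prod_mul_distrib, Finset.prod_const, Finset.card_univ]
  constructor
  · have := (hadd.sub (boxAdditive_prod.const_mul ((2 * L)⁻¹ ^ Fintype.card ι))).nonneg_of_small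
      hL (fun a l hl hl' => ?_) a l hl
    · linarith
    rw [sub_nonneg, hpow]
    have h1 : ∏ i, (2 * L)⁻¹ * l i ≤ 1 := by
      refine Finset.prod_le_one (fun i _ => mul_nonneg (by positivity) (hL.le.trans (hl i)))
        fun i _ => ?_
      rw [inv_mul_le_iff₀ (by positivity)]; linarith [hl' i]
    refine h1.trans ?_
    obtain ⟨y, hy, hxy⟩ := hdense fun i => a i + l i / 2
    have hyb : y ∈ box a l := mem_box.2 fun i => by
      have := (dist_le_pi_dist _ y i).trans hxy
      rw [Real.dist_eq, abs_le] at this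
      constructor <;> linarith [hl i]
    have h2 : (Measure.count.restrict D).real {y} = 1 := by
      rw [Measure.real, Measure.restrict_apply' hD, inter_eq_left.2 (singleton_subset_iff.2 hy)]
      simp
    rw [← h2]
    exact measureReal_mono (singleton_subset_iff.2 hyb) (hfin a l)
  · have := ((boxAdditive_prod.const_mul ((r / 4)⁻¹ ^ Fintype.card ι)).sub hadd).nonneg_of_small
      (L := r / 4) (by positivity) (fun a l hl hl' => ?_) a l fun i => hLr.trans (hl i)
    · linarith
    rw [sub_nonneg, hpow]
    have h1 : 1 ≤ ∏ i, (r / 4)⁻¹ * l i := by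
      refine Finset.one_le_prod fun i _ => ?_
      rw [le_inv_mul_iff₀ (by positivity)]; linarith [hl i]
    refine le_trans ?_ h1
    have hsub : (box a l ∩ D).Subsingleton := fun x hx y hy => by
      by_contra hxy
      have h2 := hsep hx.2 hy.2 hxy
      have h3 : dist x y ≤ r / 2 := (dist_pi_le_iff (by positivity)).2 fun i => by
        have h4 := mem_box.1 hx.1 i
        have h5 := mem_box.1 hy.1 i
        rw [Real.dist_eq, abs_le]
        constructor <;> linarith [hl' i]
      linarith
    refine ENNReal.toReal_le_of_le_ofReal zero_le_one ?_
    rw [Measure.restrict_apply' hD, ENNReal.ofReal_one, Measure.count_apply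
      ((measurableSet_box a l).inter hD)]
    exact_mod_cast Set.encard_le_one_iff_subsingleton.2 hsub

theorem boxRepetitive_count (hD : MeasurableSet D) {C L₀ κ : ℝ} (hL₀ : 1 ≤ L₀)
    (hκ : 2 * C + 4 ≤ κ)
    (hrep : ∀ ρ : ℝ, 1 ≤ ρ → ∀ x y : ι → ℝ, ∃ t, (∀ p, dist p x ≤ ρ → (p + t ∈ D ↔ p ∈ D)) ∧
      dist (x + t) y ≤ C * ρ) :
    BoxRepetitive (fun a l => (Measure.count.restrict D).real (box a l)) L₀ κ := by
  intro L hL a l hl hl' b m hm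
  obtain ⟨t, ht, hxy⟩ := hrep L (hL₀.trans hL) (fun i => a i + l i / 2) fun i => b i + m i / 2
  have hcoord : ∀ i, |a i + l i / 2 + t i - (b i + m i / 2)| ≤ C * L := fun i => by
    have := (dist_le_pi_dist _ _ i).trans hxy
    rwa [Real.dist_eq] at this
  have hκL : (2 * C + 4) * L ≤ κ * L := mul_le_mul_of_nonneg_right hκ (by linarith)
  refine ⟨a + t, ?_, fun i => ?_, fun i => ?_⟩
  · have himg : box (a + t) l ∩ D = (fun p => p + t) '' (box a l ∩ D) := by
      have key : ∀ p ∈ box a l, (p + t ∈ D ↔ p ∈ D) := fun p hp => by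
        refine ht p ((dist_pi_le_iff (by linarith)).2 fun i => ?_)
        have := mem_box.1 hp i
        rw [Real.dist_eq, abs_le]
        constructor <;> linarith [hl' i]
      ext q
      constructor
      · rintro ⟨hq, hqD⟩
        have hq' : q - t ∈ box a l := add_mem_box_add.1 (by rwa [sub_add_cancel])
        exact ⟨q - t, ⟨hq', (key _ hq').1 (by rwa [sub_add_cancel])⟩, sub_add_cancel _ _⟩
      · rintro ⟨p, ⟨hp, hpD⟩, rfl⟩
        exact ⟨add_mem_box_add.2 hp, (key p hp).2 hpD⟩
    simp only [Measure.real]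
    rw [Measure.restrict_apply' hD, Measure.restrict_apply' hD,
      Measure.count_apply ((measurableSet_box _ _).inter hD),
      Measure.count_apply ((measurableSet_box _ _).inter hD), himg,
      (add_left_injective t).injOn.encard_image]
  · have h1 := (abs_le.1 (hcoord i)).1
    have h2 := hm i
    have h3 := hl' i
    simp only [Pi.add_apply]
    linarith
  · have h1 := (abs_le.1 (hcoord i)).2
    have h2 := hm i
    have h3 := hl' i
    simp only [Pi.add_apply]
    linarith

/-- Linearly repetitive Delone sets for the supremum distance are bi-Lipschitz equivalent
to the integer lattice. -/
theorem exists_bilipschitz_bijective_int [Nonempty ι] {r R C : ℝ} (hr : 0 < r)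
    (hsep : D.Pairwise fun x y => r ≤ dist x y) (hdense : ∀ x, ∃ y ∈ D, dist x y ≤ R)
    (hrep : ∀ ρ : ℝ, 1 ≤ ρ → ∀ x y : ι → ℝ, ∃ t, (∀ p, dist p x ≤ ρ → (p + t ∈ D ↔ p ∈ D)) ∧
      dist (x + t) y ≤ C * ρ) :
    ∃ f : D → ι → ℤ, Function.Bijective f ∧ ∃ K : ℝ, 1 ≤ K ∧ ∀ u v : D,
      dist u v ≤ K * dist (f u) (f v) ∧ dist (f u) (f v) ≤ K * dist u v := by
  classical
  have hD : MeasurableSet D := (Metric.isClosed_of_pairwise_le_dist hr hsep).measurableSet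
  have := isLocallyFiniteMeasure_count_restrict hD hr hsep
  set L : ℝ := max 1 (max (r / 4) (2 * R + 1)) with hLdef
  have hL1 : 1 ≤ L := le_max_left _ _
  have hLr : r / 4 ≤ L := (le_max_left _ _).trans (le_max_right _ _)
  have hLR : 2 * R + 1 ≤ L := (le_max_right _ _).trans (le_max_right _ _)
  have hL0 : 0 < L := by linarith
  obtain ⟨k, hk⟩ := pow_unbounded_of_one_lt (2 * C + 4) one_lt_two
  obtain ⟨δ, hδ, e, hs, he, h⟩ := exists_density (boxAdditive_measure (Measure.count.restrict D))
    (k := k) hL0 (boxRepetitive_count hD hL1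
      (hk.le.trans (pow_le_pow_right₀ one_le_two (Nat.le_succ k))) hrep) (by positivity)
    (densityBounds_count hD hr hsep hdense hL0 hLr (by linarith))
  obtain ⟨K, a, c, H, ha, hc, hH, hH', f, hf, hfH⟩ :=
    exists_bijective_lattice hD hδ hL0 hs he fun n a l => h n a l
  exact ⟨f, hf, bilipschitz_of_dist_le hr hsep ha hc hH hH' hf.1 hfH⟩

end Rectifiable

/-- Every linearly repetitive Delone set in ℝ^d is rectifiable: there is a bi-Lipschitz
bijection f : D → ℤ^d. -/
theorem linearly_repetitive_delone_rectifiable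
    (d : ℕ) (hd : 1 ≤ d) (D : Set (EuclideanSpace ℝ (Fin d)))
    -- D is a Delone set:
    (r R : ℝ) (hr : 0 < r) (hR : 0 < R)
    (hUnifDisc : ∀ x ∈ D, ∀ y ∈ D, x ≠ y → r ≤ dist x y)
    (hRelDense : ∀ x : EuclideanSpace ℝ (Fin d), ∃ y ∈ D, dist x y ≤ R)
    -- D is linearly repetitive:
    (C : ℝ) (hC : 1 ≤ C)
    (hLinRep : ∀ ρ : ℝ, 1 ≤ ρ → ∀ x y : EuclideanSpace ℝ (Fin d),
      ∃ t : EuclideanSpace ℝ (Fin d),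
        (fun p => t + p) '' (D ∩ Metric.closedBall x ρ) = D ∩ Metric.closedBall (x + t) ρ ∧
        Metric.closedBall (x + t) ρ ⊆ Metric.closedBall y (C * ρ)) :
    -- conclusion: a bi-Lipschitz bijection f : D → ℤ^d
    ∃ f : D → intLattice d, Function.Bijective f ∧
      ∃ K : ℝ, 1 ≤ K ∧ ∀ u v : D,
        (1 / K) * ‖(u : EuclideanSpace ℝ (Fin d)) - (v : EuclideanSpace ℝ (Fin d))‖
            ≤ ‖(f u : EuclideanSpace ℝ (Fin d)) - (f v : EuclideanSpace ℝ (Fin d))‖ ∧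
        ‖(f u : EuclideanSpace ℝ (Fin d)) - (f v : EuclideanSpace ℝ (Fin d))‖
            ≤ K * ‖(u : EuclideanSpace ℝ (Fin d)) - (v : EuclideanSpace ℝ (Fin d))‖ := by
  have hup : ∀ x y : EuclideanSpace ℝ (Fin d), dist (WithLp.ofLp x) (WithLp.ofLp y) ≤ dist x y :=
    fun x y => by simpa using (PiLp.lipschitzWith_ofLp 2 fun _ : Fin d => ℝ).dist_le_mul x y
  obtain ⟨M, hM, hlo⟩ : ∃ M : ℝ, 1 ≤ M ∧ ∀ x y : EuclideanSpace ℝ (Fin d),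
      dist x y ≤ M * dist (WithLp.ofLp x) (WithLp.ofLp y) :=
    ⟨_ + 1, le_add_of_nonneg_left (NNReal.coe_nonneg _), fun x y =>
      ((PiLp.antilipschitzWith_ofLp 2 fun _ : Fin d => ℝ).le_mul_dist x y).trans
        (mul_le_mul_of_nonneg_right (le_add_of_nonneg_right zero_le_one) dist_nonneg)⟩
  have hM0 : 0 < M := one_pos.trans_le hM
  have : Nonempty (Fin d) := ⟨⟨0, hd⟩⟩
  have hsep : (WithLp.toLp 2 ⁻¹' D).Pairwise fun x y : Fin d → ℝ => r / M ≤ dist x y := by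
    intro x hx y hy hxy
    rw [div_le_iff₀' hM0]
    exact (hUnifDisc _ hx _ hy fun h => hxy (WithLp.toLp_injective 2 h)).trans (hlo _ _)
  have hdense : ∀ x : Fin d → ℝ, ∃ y ∈ WithLp.toLp 2 ⁻¹' D, dist x y ≤ R := fun x => by
    obtain ⟨y, hy, hxy⟩ := hRelDense (WithLp.toLp 2 x)
    exact ⟨WithLp.ofLp y, hy, (hup _ _).trans hxy⟩
  have hrep : ∀ ρ : ℝ, 1 ≤ ρ → ∀ x y : Fin d → ℝ, ∃ t : Fin d → ℝ,
      (∀ p, dist p x ≤ ρ → (p + t ∈ WithLp.toLp 2 ⁻¹' D ↔ p ∈ WithLp.toLp 2 ⁻¹' D)) ∧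
        dist (x + t) y ≤ C * M * ρ := fun ρ hρ x y => by
    have hMρ : 1 ≤ M * ρ := one_le_mul_of_one_le_of_one_le hM hρ
    obtain ⟨t, ht, ht'⟩ := hLinRep (M * ρ) hMρ (WithLp.toLp 2 x) (WithLp.toLp 2 y)
    refine ⟨WithLp.ofLp t, fun p hp => ?_, ?_⟩
    · have hpx : WithLp.toLp 2 p ∈ Metric.closedBall (WithLp.toLp 2 x) (M * ρ) :=
        (hlo _ _).trans (mul_le_mul_of_nonneg_left hp hM0.le)
      constructor
      · intro hpt
        have : t + WithLp.toLp 2 p ∈ D ∩ Metric.closedBall (WithLp.toLp 2 x + t) (M * ρ) := by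
          refine ⟨by rw [add_comm]; exact hpt, ?_⟩
          rw [Metric.mem_closedBall, add_comm, dist_add_right]
          exact hpx
        rw [← ht] at this
        obtain ⟨q, hq, hqp⟩ := this
        have hqp : q = WithLp.toLp 2 p := add_left_cancel hqp
        change WithLp.toLp 2 p ∈ D
        exact hqp ▸ hq.1
      · intro hpD
        have : t + WithLp.toLp 2 p ∈ D ∩ Metric.closedBall (WithLp.toLp 2 x + t) (M * ρ) :=
          ht ▸ mem_image_of_mem _ ⟨hpD, hpx⟩
        rw [add_comm t] at this
        exact this.1
    · rw [mul_assoc]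
      exact (hup (WithLp.toLp 2 x + t) (WithLp.toLp 2 y)).trans
        (ht' (Metric.mem_closedBall_self (by linarith)))
  obtain ⟨f, hf, K, hK, hfK⟩ :=
    exists_bilipschitz_bijective_int (div_pos hr hM0) hsep hdense hrep
  have hdist : ∀ z w : Fin d → ℤ,
      dist (fun i => (z i : ℝ)) (fun i => (w i : ℝ)) = dist z w := fun _ _ => rfl
  refine ⟨fun u => ⟨WithLp.toLp 2 fun i => (f ⟨WithLp.ofLp u.1, u.2⟩ i : ℝ), fun i => ⟨_, rfl⟩⟩,
    ⟨fun u v huv => ?_, fun z => ?_⟩, M * K, one_le_mul_of_one_le_of_one_le hM hK, fun u v => ?_⟩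
  · have h1 := hf.1 (funext fun i => Int.cast_injective (α := ℝ)
      (congrFun (WithLp.toLp_injective 2 (congrArg Subtype.val huv)) i))
    exact Subtype.ext (WithLp.ofLp_injective 2 (congrArg Subtype.val h1))
  · choose n hn using z.2
    obtain ⟨p, hp⟩ := hf.2 n
    refine ⟨⟨WithLp.toLp 2 p.1, p.2⟩, Subtype.ext ?_⟩
    ext i
    rw [hn i, ← hp]
  · rw [← dist_eq_norm, ← dist_eq_norm]
    obtain ⟨h1, h2⟩ := hfK ⟨WithLp.ofLp u.1, u.2⟩ ⟨WithLp.ofLp v.1, v.2⟩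
    rw [← hdist] at h1 h2
    have hMK : 0 < M * K := by positivity
    constructor
    · rw [one_div, inv_mul_le_iff₀ hMK, mul_assoc]
      refine (hlo _ _).trans (mul_le_mul_of_nonneg_left (h1.trans ?_) hM0.le)
      exact mul_le_mul_of_nonneg_left (hup (WithLp.toLp 2 _) (WithLp.toLp 2 _)) (by linarith)
    · rw [mul_assoc]
      refine (hlo _ _).trans (mul_le_mul_of_nonneg_left (h2.trans ?_) hM0.le)
      exact mul_le_mul_of_nonneg_left (hup u v) (by linarith)
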